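/- arXiv:math/0702444 — 2 statements merged into one kernel-verified Lean document; each statement's English description precedes it below -/
import Mathlib

section
/- Let K be a field of characteristic zero, R = K[x_1, ..., x_n] the standard graded polynomial ring, a a positive integer, and I = (p_a, p_{a+1}, ..., p_{a+n−1}) the ideal generated by the power sums of the n consecutive degrees a, a+1, ..., a+n−1. Then A = R/I is an Artinian complete intersection and A has the SLP. -/
set_option maxHeartbeats 1000000
set_option synthInstance.maxHeartbeats 400000

open TensorProduct

section LefschetzPrelude

variable (K : Type) [Field K]

/-- `𝒜` makes `A` into a graded Artinian `K`-algebra (with possibly non-standard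
grading): `A` is the internal direct sum of the `𝒜 i`, the grading is
multiplicative, `A₀ = K·1` and `A` is finite dimensional over `K`. -/
def IsGradedArtinAlg {A : Type} [CommRing A] [Algebra K A]
    (𝒜 : ℕ → Submodule K A) : Prop :=
  DirectSum.IsInternal 𝒜 ∧
  (1 : A) ∈ 𝒜 0 ∧
  (∀ i j : ℕ, ∀ x ∈ 𝒜 i, ∀ y ∈ 𝒜 j, x * y ∈ 𝒜 (i + j)) ∧
  𝒜 0 = Submodule.span K {(1 : A)} ∧
  FiniteDimensional K A

/-- `c` is the top degree of the grading `𝒜`. -/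
def GradedTop {A : Type} [CommRing A] [Algebra K A]
    (𝒜 : ℕ → Submodule K A) (c : ℕ) : Prop :=
  𝒜 c ≠ ⊥ ∧ ∀ i : ℕ, c < i → 𝒜 i = ⊥

/-- `ℳ` makes the `A`-module `V` into a finite graded module over the graded
algebra `(A, 𝒜)`. -/
def IsGradedMod {A V : Type} [CommRing A] [Algebra K A] [AddCommGroup V]
    [Module K V] [Module A V] [IsScalarTower K A V]
    (𝒜 : ℕ → Submodule K A) (ℳ : ℤ → Submodule K V) : Prop :=
  DirectSum.IsInternal ℳ ∧
  (∀ (i : ℕ) (j : ℤ), ∀ a ∈ 𝒜 i, ∀ v ∈ ℳ j, a • v ∈ ℳ (j + i)) ∧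
  FiniteDimensional K V

/-- The graded pieces of `ℳ` are supported exactly between degrees `a` and `b`. -/
def GradedBetween {V : Type} [AddCommGroup V] [Module K V]
    (ℳ : ℤ → Submodule K V) (a b : ℤ) : Prop :=
  a ≤ b ∧ ℳ a ≠ ⊥ ∧ ℳ b ≠ ⊥ ∧ ∀ i : ℤ, i < a ∨ b < i → ℳ i = ⊥

/-- Multiplication by `g : A` on the `A`-module `V`, as a `K`-linear endomorphism. -/
noncomputable def mulMap {A : Type} (V : Type) [CommRing A] [Algebra K A] [AddCommGroup V]
    [Module K V] [Module A V] [IsScalarTower K A V] (g : A) : Module.End K V :=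
  (LinearMap.lsmul A V g).restrictScalars K

/-- The endomorphism `f` of the graded vector space `ℳ` (supported between
degrees `a` and `b`) is a weak Lefschetz operator: each `f : ℳ i → ℳ (i+1)` is
injective or surjective. -/
def IsWLEndo {V : Type} [AddCommGroup V] [Module K V]
    (ℳ : ℤ → Submodule K V) (a b : ℤ) (f : Module.End K V) : Prop :=
  ∀ i : ℤ, a ≤ i → i + 1 ≤ b →
    ((∀ v ∈ ℳ i, f v = 0 → v = 0) ∨ (∀ w ∈ ℳ (i + 1), ∃ v ∈ ℳ i, f v = w))

/-- The endomorphism `f` of the graded vector space `ℳ` (supported between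
degrees `a` and `b`) is a strong Lefschetz operator:
`f^(b-a-2i) : ℳ (a+i) → ℳ (b-i)` is bijective for all `0 ≤ 2i ≤ b-a`. -/
def IsSLEndo {V : Type} [AddCommGroup V] [Module K V]
    (ℳ : ℤ → Submodule K V) (a b : ℤ) (f : Module.End K V) : Prop :=
  ∀ i : ℕ, 2 * (i : ℤ) ≤ b - a →
    (∀ v ∈ ℳ (a + i), (f ^ (b - a - 2 * i).toNat) v = 0 → v = 0) ∧
    (∀ w ∈ ℳ (b - i), ∃ v ∈ ℳ (a + i), (f ^ (b - a - 2 * i).toNat) v = w)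

/-- `g ∈ A₁` is a weak Lefschetz element for the graded module `(V, ℳ)`. -/
def IsWLElem {A V : Type} [CommRing A] [Algebra K A] [AddCommGroup V]
    [Module K V] [Module A V] [IsScalarTower K A V]
    (𝒜 : ℕ → Submodule K A) (ℳ : ℤ → Submodule K V) (a b : ℤ) (g : A) : Prop :=
  g ∈ 𝒜 1 ∧ IsWLEndo K ℳ a b (mulMap K V g)

/-- `g ∈ A₁` is a strong Lefschetz element for the graded module `(V, ℳ)`. -/
def IsSLElem {A V : Type} [CommRing A] [Algebra K A] [AddCommGroup V]
    [Module K V] [Module A V] [IsScalarTower K A V]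
    (𝒜 : ℕ → Submodule K A) (ℳ : ℤ → Submodule K V) (a b : ℤ) (g : A) : Prop :=
  g ∈ 𝒜 1 ∧ IsSLEndo K ℳ a b (mulMap K V g)

/-- The Hilbert function of the graded vector space `ℳ`. -/
noncomputable def hilb {V : Type} [AddCommGroup V] [Module K V]
    (ℳ : ℤ → Submodule K V) (i : ℤ) : ℕ :=
  Module.finrank K (ℳ i)

/-- The Hilbert function of `ℳ`, supported between `a` and `b`, is symmetric. -/
def SymHilb {V : Type} [AddCommGroup V] [Module K V]
    (ℳ : ℤ → Submodule K V) (a b : ℤ) : Prop :=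
  ∀ i : ℤ, hilb K ℳ (a + i) = hilb K ℳ (b - i)

/-- The Hilbert function of `ℳ`, supported between `a` and `b`, is unimodal. -/
def UnimodalHilb {V : Type} [AddCommGroup V] [Module K V]
    (ℳ : ℤ → Submodule K V) (a b : ℤ) : Prop :=
  ∃ m : ℤ, a ≤ m ∧ m ≤ b ∧
    (∀ i j : ℤ, a ≤ i → i ≤ j → j ≤ m → hilb K ℳ i ≤ hilb K ℳ j) ∧
    (∀ i j : ℤ, m ≤ i → i ≤ j → j ≤ b → hilb K ℳ j ≤ hilb K ℳ i)

/-- The Sperner number of `ℳ` (supported between `a` and `b`). -/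
noncomputable def sperner {V : Type} [AddCommGroup V] [Module K V]
    (ℳ : ℤ → Submodule K V) (a b : ℤ) : ℕ :=
  (Finset.Icc a b).sup fun i => hilb K ℳ i

/-- The CoSperner number of `ℳ` (supported between `a` and `b`). -/
noncomputable def coSperner {V : Type} [AddCommGroup V] [Module K V]
    (ℳ : ℤ → Submodule K V) (a b : ℤ) : ℕ :=
  ∑ i ∈ Finset.Icc a (b - 1), min (hilb K ℳ i) (hilb K ℳ (i + 1))

/-- `SP_k(V) = Σ_{i=a}^{b} max (dim V_i - dim V_{i-k}) 0` (via truncated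
subtraction on `ℕ`). -/
noncomputable def spernerVec {V : Type} [AddCommGroup V] [Module K V]
    (ℳ : ℤ → Submodule K V) (a b : ℤ) (k : ℕ) : ℕ :=
  ∑ i ∈ Finset.Icc a b, (hilb K ℳ i - hilb K ℳ (i - (k : ℤ)))

/-- `d` is the multiset of Jordan block sizes of the (nilpotent) endomorphism `f`:
all entries are positive and `dim ker f^k = Σ_{n ∈ d} min n k` for every `k`. -/
def IsJordanType {V : Type} [AddCommGroup V] [Module K V]
    (f : Module.End K V) (d : Multiset ℕ) : Prop :=
  (∀ n ∈ d, 0 < n) ∧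
  ∀ k : ℕ, Module.finrank K (LinearMap.ker (f ^ k)) = (d.map fun n => min n k).sum

/-- `g ∈ A₁` is a weak Lefschetz element of the graded algebra `(A, 𝒜)` with top
degree `c`. -/
def IsAlgWLElem {A : Type} [CommRing A] [Algebra K A]
    (𝒜 : ℕ → Submodule K A) (c : ℕ) (g : A) : Prop :=
  g ∈ 𝒜 1 ∧ ∀ i : ℕ, i + 1 ≤ c →
    ((∀ v ∈ 𝒜 i, g * v = 0 → v = 0) ∨ (∀ w ∈ 𝒜 (i + 1), ∃ v ∈ 𝒜 i, g * v = w))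

/-- `g ∈ A₁` is a strong Lefschetz element of the graded algebra `(A, 𝒜)` with top
degree `c`: `×g^(c-2i) : A_i → A_{c-i}` is bijective for `0 ≤ 2i ≤ c`. -/
def IsAlgSLElem {A : Type} [CommRing A] [Algebra K A]
    (𝒜 : ℕ → Submodule K A) (c : ℕ) (g : A) : Prop :=
  g ∈ 𝒜 1 ∧ ∀ i : ℕ, 2 * i ≤ c →
    (∀ v ∈ 𝒜 i, g ^ (c - 2 * i) * v = 0 → v = 0) ∧
    (∀ w ∈ 𝒜 (c - i), ∃ v ∈ 𝒜 i, g ^ (c - 2 * i) * v = w)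

/-- The graded algebra `(A, 𝒜)` has the weak Lefschetz property. -/
def AlgHasWLP {A : Type} [CommRing A] [Algebra K A] (𝒜 : ℕ → Submodule K A) : Prop :=
  ∃ c : ℕ, GradedTop K 𝒜 c ∧ ∃ g : A, IsAlgWLElem K 𝒜 c g

/-- The graded algebra `(A, 𝒜)` has the strong Lefschetz property. -/
def AlgHasSLP {A : Type} [CommRing A] [Algebra K A] (𝒜 : ℕ → Submodule K A) : Prop :=
  ∃ c : ℕ, GradedTop K 𝒜 c ∧ ∃ g : A, IsAlgSLElem K 𝒜 c g

/-- The graded pieces of the tensor product `V ⊗[K] W` of two graded vector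
spaces: `(ℳ ⊗ 𝒩)_k = Σ_{i+j=k} ℳ_i ⊗ 𝒩_j`. -/
noncomputable def tensorGrading {V W : Type} [AddCommGroup V] [Module K V]
    [AddCommGroup W] [Module K W] (ℳ : ℤ → Submodule K V) (𝒩 : ℤ → Submodule K W)
    (k : ℤ) : Submodule K (V ⊗[K] W) :=
  ⨆ i : ℤ, LinearMap.range (TensorProduct.map (ℳ i).subtype (𝒩 (k - i)).subtype)

/-- Reindex a `ℕ`-indexed grading by `ℤ`. -/
noncomputable def natToZ {V : Type} [AddCommGroup V] [Module K V]
    (ℒ : ℕ → Submodule K V) (i : ℤ) : Submodule K V :=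
  if 0 ≤ i then ℒ i.toNat else ⊥

/-- The truncated polynomial ring `K[t]/(t^α)`. -/
abbrev TruncPoly (α : ℕ) : Type :=
  Polynomial K ⧸ Ideal.span {(Polynomial.X : Polynomial K) ^ α}

/-- The image of `t` in `K[t]/(t^α)`. -/
noncomputable def tbar (α : ℕ) : TruncPoly K α :=
  Ideal.Quotient.mk _ Polynomial.X

/-- The standard grading of `K[t]/(t^α)` (with `deg t = 1`): the degree-`j` piece
is spanned by the class of `t^j` for `0 ≤ j < α`, and is zero otherwise. -/
noncomputable def truncGrading (α : ℕ) (j : ℤ) : Submodule K (TruncPoly K α) :=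
  if 0 ≤ j ∧ j < (α : ℤ) then Submodule.span K {tbar K α ^ j.toNat} else ⊥

end LefschetzPrelude

section PolyPrelude

variable (K : Type) [Field K] (n : ℕ)

/-- The subring `S = K[e₁, …, e_n]` of symmetric polynomials of
`R = K[x₁, …, x_n]`. -/
noncomputable def symS : Subalgebra K (MvPolynomial (Fin n) K) :=
  MvPolynomial.symmetricSubalgebra (Fin n) K

theorem mem_symS (p : MvPolynomial (Fin n) K) :
    p ∈ symS K n ↔ p.IsSymmetric :=
  MvPolynomial.mem_symmetricSubalgebra p

/-- The power sum `p_d = x₁^d + ⋯ + x_n^d`, as an element of `S`. -/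
noncomputable def psumS (d : ℕ) : ↥(symS K n) :=
  ⟨MvPolynomial.psum (Fin n) K d,
    (mem_symS K n _).mpr (MvPolynomial.psum_isSymmetric _ _ d)⟩

/-- The elementary symmetric polynomial `e_k`, as an element of `S`. -/
noncomputable def esymmS (k : ℕ) : ↥(symS K n) :=
  ⟨MvPolynomial.esymm (Fin n) K k,
    (mem_symS K n _).mpr (MvPolynomial.esymm_isSymmetric _ _ k)⟩

/-- The standard grading on a quotient `R/I` of the polynomial ring
`R = K[x₁, …, x_n]`: the degree-`d` piece is the image of the space of
homogeneous polynomials of degree `d`. -/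
noncomputable def quotGrading (I : Ideal (MvPolynomial (Fin n) K)) (d : ℕ) :
    Submodule K (MvPolynomial (Fin n) K ⧸ I) :=
  Submodule.map (Ideal.Quotient.mkₐ K I).toLinearMap
    (MvPolynomial.homogeneousSubmodule (Fin n) K d)

/-- The (non-standard) grading on a quotient `S/J` of the ring of symmetric
polynomials, `S_j = S ∩ R_j`: the degree-`d` piece is the image of
`S ∩ (homogeneous polynomials of degree d)`. -/
noncomputable def symQuotGrading (J : Ideal ↥(symS K n)) (d : ℕ) :
    Submodule K (↥(symS K n) ⧸ J) :=
  Submodule.map (Ideal.Quotient.mkₐ K J).toLinearMap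
    (Submodule.comap (symS K n).val.toLinearMap
      (MvPolynomial.homogeneousSubmodule (Fin n) K d))

end PolyPrelude

section SlTwo

variable {K W : Type*} [Field K] [AddCommGroup W] [Module K W]

theorem pow_raise_lower (e f : Module.End K W) (V : ℕ → Submodule K W) (c : ℕ)
    (he : ∀ i, ∀ v ∈ V i, e v ∈ V (i + 1))
    (hef : ∀ i, ∀ v ∈ V i, e (f v) - f (e v) = (2 * i - c : K) • v)
    (i m : ℕ) (v : W) (hv : v ∈ V i) :
    (e ^ (m + 1)) (f v) =
      f ((e ^ (m + 1)) v) + ((m + 1) * (2 * i - c + m) : K) • (e ^ m) v := by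
  have hmem : ∀ m, (e ^ m) v ∈ V (i + m) := fun m => by
    induction m with
    | zero => simpa using hv
    | succ m ih =>
      rw [pow_succ', Module.End.mul_apply]
      exact he _ _ ih
  induction m with
  | zero =>
    have := hef i v hv
    rw [sub_eq_iff_eq_add'] at this
    simpa using this
  | succ m ih =>
    have h := hef _ _ (hmem (m + 1))
    rw [sub_eq_iff_eq_add'] at h
    rw [pow_succ', Module.End.mul_apply, ih, map_add, h, map_smul,
      ← Module.End.mul_apply e (e ^ m), ← pow_succ', ← Module.End.mul_apply e (e ^ (m + 1)),
      ← pow_succ', add_assoc, ← add_smul]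
    congr 2
    push_cast
    ring

/-- A lowest weight vector is not killed by small powers of the raising operator. -/
theorem eq_zero_of_lower_eq_zero [CharZero K] (e f : Module.End K W) (V : ℕ → Submodule K W)
    (c : ℕ) (he : ∀ i, ∀ v ∈ V i, e v ∈ V (i + 1))
    (hef : ∀ i, ∀ v ∈ V i, e (f v) - f (e v) = (2 * i - c : K) • v)
    (i : ℕ) (v : W) (hv : v ∈ V i) (hfv : f v = 0) (m : ℕ) (hm : 2 * i + m ≤ c)
    (h : (e ^ m) v = 0) : v = 0 := by
  induction m with
  | zero => simpa using h
  | succ m ih =>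
    have key := pow_raise_lower e f V c he hef _ m v hv
    rw [hfv, h, map_zero, map_zero, zero_add] at key
    rcases smul_eq_zero.1 key.symm with h3 | h3
    · exfalso
      have : ((m + 1 : ℕ) : K) * ((c - (2 * i + m) : ℕ) : K) = 0 := by
        rw [Nat.cast_sub (by omega)]
        push_cast
        linear_combination -h3
      rw [← Nat.cast_mul, Nat.cast_eq_zero, Nat.mul_eq_zero] at this
      omega
    · exact ih (by omega) h3

/-- A raising operator `e` that is part of an `sl₂`-triple on a graded vector space centred at
`c / 2` is a strong Lefschetz operator (injectivity part). -/
theorem eq_zero_of_raise_pow_eq_zero [CharZero K] (e f : Module.End K W)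
    (V : ℕ → Submodule K W) (c : ℕ)
    (he : ∀ i, ∀ v ∈ V i, e v ∈ V (i + 1))
    (hf0 : ∀ v ∈ V 0, f v = 0)
    (hf : ∀ i, ∀ v ∈ V (i + 1), f v ∈ V i)
    (hef : ∀ i, ∀ v ∈ V i, e (f v) - f (e v) = (2 * i - c : K) • v)
    (i k : ℕ) (hik : 2 * i + k = c) (v : W) (hv : v ∈ V i) (h : (e ^ k) v = 0) : v = 0 := by
  refine eq_zero_of_lower_eq_zero e f V c he hef i v hv ?_ k hik.le h
  induction i generalizing k v with
  | zero => exact hf0 v hv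
  | succ i ih =>
    have key := pow_raise_lower e f V c he hef _ (k + 1) v hv
    have h1 : (e ^ (k + 1)) v = 0 := by rw [pow_succ', Module.End.mul_apply, h, map_zero]
    have h2 : (e ^ (k + 1 + 1)) v = 0 := by rw [pow_succ', Module.End.mul_apply, h1, map_zero]
    rw [h1, h2, map_zero, smul_zero, add_zero] at key
    exact eq_zero_of_lower_eq_zero e f V c he hef i _ (hf _ _ hv)
      (ih (k + 1 + 1) (by omega) _ (hf _ _ hv) key) _ (by omega) key

end SlTwo

section Box

open Finset

variable {ι : Type}

/-- The exponent vectors of the monomial basis of `K[z]/(z_i ^ d_i)`. -/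
abbrev Box (d : ι → ℕ) : Type := {β : ι → ℕ // ∀ i, β i < d i}

noncomputable instance Box.instFintype [Fintype ι] (d : ι → ℕ) : Fintype (Box d) := by
  classical
  exact Fintype.ofInjective (fun (β : Box d) (i : ι) => (⟨β.1 i, β.2 i⟩ : Fin (d i)))
    fun β γ h => Subtype.ext (funext fun i => congrArg Fin.val (congrFun h i))

/-- The reflection of the box. -/
def Box.rev {d : ι → ℕ} (β : Box d) : Box d :=
  ⟨fun i => d i - 1 - β.1 i, fun i => by have := β.2 i; lia⟩

theorem Box.rev_rev {d : ι → ℕ} (β : Box d) : β.rev.rev = β :=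
  Subtype.ext (funext fun i => by have := β.2 i; simp only [Box.rev]; lia)

theorem sub_single_add_single [DecidableEq ι] {α : ι → ℕ} {i : ι} (h : 1 ≤ α i) :
    α - Pi.single i 1 + Pi.single i 1 = α := by
  funext j
  rcases eq_or_ne j i with rfl | hj
  · simp [h]
  · simp [hj]

variable [Fintype ι]

/-- The weight of an exponent vector. -/
def expWeight (w : ι → ℕ) (α : ι → ℕ) : ℕ := ∑ i, w i * α i

theorem expWeight_add (w α β : ι → ℕ) :
    expWeight w (α + β) = expWeight w α + expWeight w β := by
  simp [expWeight, mul_add, sum_add_distrib]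

theorem expWeight_single [DecidableEq ι] (w : ι → ℕ) (i : ι) (m : ℕ) :
    expWeight w (Pi.single i m) = w i * m := by
  rw [expWeight, sum_eq_single i] <;> simp +contextual

/-- The degree of an exponent vector. -/
abbrev expDegree (α : ι → ℕ) : ℕ := expWeight 1 α

theorem expDegree_add (α β : ι → ℕ) : expDegree (α + β) = expDegree α + expDegree β :=
  expWeight_add 1 α β

theorem expDegree_single [DecidableEq ι] (i : ι) (m : ℕ) :
    expDegree (Pi.single i m) = m := by
  simp [expWeight_single]

theorem Box.degree_rev {d : ι → ℕ} (β : Box d) :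
    expDegree β.rev.1 + expDegree β.1 = ∑ i, (d i - 1) := by
  simp only [expDegree, expWeight, ← sum_add_distrib, Pi.one_apply, one_mul]
  exact sum_congr rfl fun i _ => by have := β.2 i; simp only [Box.rev]; lia

variable {K : Type} [Field K]

open Classical in
/-- Multiplication by `∑ z_i` on `K[z]/(z_i ^ d_i)`, in coordinates. -/
noncomputable def boxRaise (K : Type) [Field K] (d : ι → ℕ) : Module.End K ((ι → ℕ) → K) where
  toFun u γ := ∑ i, if 1 ≤ γ i ∧ γ i < d i then u (γ - Pi.single i 1) else 0
  map_add' u v := by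
    funext γ
    simp only [Pi.add_apply, ← sum_add_distrib]
    exact sum_congr rfl fun i _ => by split_ifs <;> simp
  map_smul' r u := by
    funext γ
    simp only [Pi.smul_apply, smul_eq_mul, mul_sum, RingHom.id_apply]
    exact sum_congr rfl fun i _ => by split_ifs <;> simp

open Classical in
/-- The operator completing `boxRaise` to an `sl₂`-triple. -/
noncomputable def boxLower (K : Type) [Field K] (d : ι → ℕ) : Module.End K ((ι → ℕ) → K) where
  toFun u γ := ∑ i, ((γ i + 1) * (d i - γ i - 1) : K) * u (γ + Pi.single i 1)
  map_add' u v := by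
    funext γ
    simp only [Pi.add_apply, ← sum_add_distrib, mul_add]
  map_smul' r u := by
    funext γ
    simp only [Pi.smul_apply, smul_eq_mul, mul_sum, RingHom.id_apply]
    exact sum_congr rfl fun i _ => by ring

/-- Functions supported on the elements of degree `k` of the box. -/
def boxPiece (K : Type) [Field K] (d : ι → ℕ) (k : ℕ) : Submodule K ((ι → ℕ) → K) where
  carrier := {u | ∀ γ, u γ ≠ 0 → (∀ i, γ i < d i) ∧ expDegree γ = k}
  add_mem' {u v} hu hv γ h := by
    by_cases h1 : u γ = 0
    · exact hv γ fun h2 => h (by simp [h1, h2])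
    · exact hu γ h1
  zero_mem' γ h := absurd rfl h
  smul_mem' r u hu γ h := hu γ fun h1 => h (by simp [h1])

theorem boxRaise_mem (d : ι → ℕ) (k : ℕ) (u : (ι → ℕ) → K) (hu : u ∈ boxPiece K d k) :
    boxRaise K d u ∈ boxPiece K d (k + 1) := by
  classical
  intro γ hγ
  obtain ⟨i, -, hi⟩ := exists_ne_zero_of_sum_ne_zero hγ
  have hi' : 1 ≤ γ i ∧ γ i < d i := by
    by_contra h
    exact hi (if_neg h)
  rw [if_pos hi'] at hi
  obtain ⟨h1, h2⟩ := hu _ hi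
  constructor
  · intro j
    rcases eq_or_ne j i with rfl | hj
    · exact hi'.2
    · simpa [hj] using h1 j
  · rw [← sub_single_add_single hi'.1, expDegree_add, h2, expDegree_single]

theorem boxLower_support (d : ι → ℕ) (k : ℕ) (u : (ι → ℕ) → K) (hu : u ∈ boxPiece K d k)
    (γ : ι → ℕ) (hγ : boxLower K d u γ ≠ 0) :
    (∀ i, γ i < d i) ∧ expDegree γ + 1 = k := by
  classical
  obtain ⟨i, -, hi⟩ := exists_ne_zero_of_sum_ne_zero hγ
  obtain ⟨h1, h2⟩ := hu _ (right_ne_zero_of_mul hi)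
  constructor
  · intro j
    refine lt_of_le_of_lt ?_ (h1 j)
    simp
  · rw [← h2, expDegree_add, expDegree_single]

theorem boxRaise_boxLower_sub (d : ι → ℕ) (hd : ∀ i, 1 ≤ d i) (k : ℕ) (u : (ι → ℕ) → K)
    (hu : u ∈ boxPiece K d k) :
    boxRaise K d (boxLower K d u) - boxLower K d (boxRaise K d u) =
      (2 * k - (∑ i, (d i - 1) : ℕ) : K) • u := by
  classical
  funext γ
  have hL : boxRaise K d (boxLower K d u) γ = ∑ i, ∑ j,
      if 1 ≤ γ i ∧ γ i < d i then
        (((γ - Pi.single i 1 : ι → ℕ) j + 1) * (d j - (γ - Pi.single i 1 : ι → ℕ) j - 1) : K) *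
          u (γ - Pi.single i 1 + Pi.single j 1) else 0 := by
    refine sum_congr rfl fun i _ => ?_
    split_ifs with h
    · rfl
    · simp
  have hR : boxLower K d (boxRaise K d u) γ = ∑ i, ∑ j,
      ((γ j + 1) * (d j - γ j - 1) : K) *
        if 1 ≤ (γ + Pi.single j 1 : ι → ℕ) i ∧ (γ + Pi.single j 1 : ι → ℕ) i < d i then
          u (γ + Pi.single j 1 - Pi.single i 1) else 0 := by
    rw [sum_comm]
    refine sum_congr rfl fun i _ => ?_
    rw [← mul_sum]
    rfl
  rw [Pi.sub_apply, hL, hR, ← sum_sub_distrib]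
  simp_rw [← sum_sub_distrib]
  have hterm : ∀ i j, ((if 1 ≤ γ i ∧ γ i < d i then
        (((γ - Pi.single i 1 : ι → ℕ) j + 1) * (d j - (γ - Pi.single i 1 : ι → ℕ) j - 1) : K) *
          u (γ - Pi.single i 1 + Pi.single j 1) else 0) -
      ((γ j + 1) * (d j - γ j - 1) : K) *
        if 1 ≤ (γ + Pi.single j 1 : ι → ℕ) i ∧ (γ + Pi.single j 1 : ι → ℕ) i < d i then
          u (γ + Pi.single j 1 - Pi.single i 1) else 0) =
      if i = j then (2 * γ i - (d i - 1 : ℕ) : K) * u γ else 0 := by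
    intro i j
    rcases eq_or_ne i j with rfl | hij
    · simp only [Pi.add_apply, Pi.sub_apply, Pi.single_eq_same, add_tsub_cancel_right, if_true]
      by_cases h0 : u γ = 0
      · by_cases h : 1 ≤ γ i
        · simp [sub_single_add_single h, h0]
        · simp [h, h0]
      · have hlt := (hu γ h0).1 i
        have hdi : ((d i - 1 : ℕ) : K) = d i - 1 := by rw [Nat.cast_sub (hd i), Nat.cast_one]
        rw [hdi]
        have h2 : ((γ i + 1) * (d i - γ i - 1) : K) *
            (if 1 ≤ γ i + 1 ∧ γ i + 1 < d i then u γ else 0) =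
            ((γ i + 1) * (d i - γ i - 1) : K) * u γ := by
          split_ifs with h
          · rfl
          · have : d i = γ i + 1 := by omega
            simp [this]
        rw [h2]
        by_cases h : 1 ≤ γ i
        · rw [if_pos ⟨h, hlt⟩, sub_single_add_single h, Nat.cast_sub h]
          push_cast
          ring
        · have h' : γ i = 0 := by omega
          simp [h']
          ring
    · have h1 : (γ - Pi.single i 1 + Pi.single j 1 : ι → ℕ) = γ + Pi.single j 1 - Pi.single i 1 := by
        funext l
        rcases eq_or_ne l i with rfl | hl
        · simp [hij]
        · simp [hl]
      simp [hij, hij.symm, h1]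
  simp_rw [hterm]
  simp only [sum_ite_eq, mem_univ, if_true, Pi.smul_apply, smul_eq_mul, ← sum_mul]
  by_cases h0 : u γ = 0
  · simp [h0]
  · rw [← (hu γ h0).2]
    congr 1
    simp [expWeight, mul_sum]

theorem boxRaise_pow_mem (d : ι → ℕ) (k m : ℕ) (u : (ι → ℕ) → K) (hu : u ∈ boxPiece K d k) :
    (boxRaise K d ^ m) u ∈ boxPiece K d (k + m) := by
  induction m with
  | zero => simpa using hu
  | succ m ih =>
    rw [pow_succ', Module.End.mul_apply]
    exact boxRaise_mem d _ _ ih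

/-- Monomial complete intersections in characteristic zero have the strong Lefschetz property
(injectivity part, in coordinates). -/
theorem eq_zero_of_boxRaise_pow_eq_zero [CharZero K] (d : ι → ℕ) (hd : ∀ i, 1 ≤ d i) (i k : ℕ)
    (hik : 2 * i + k = ∑ i, (d i - 1)) (u : (ι → ℕ) → K) (hu : u ∈ boxPiece K d i)
    (h : (boxRaise K d ^ k) u = 0) : u = 0 := by
  refine eq_zero_of_raise_pow_eq_zero (boxRaise K d) (boxLower K d) (boxPiece K d) _
    (boxRaise_mem d) (fun v hv => ?_) (fun j v hv γ hγ => ?_)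
    (fun j v hv => boxRaise_boxLower_sub d hd j v hv) i k hik u hu h
  · funext γ
    by_contra hγ
    exact absurd (boxLower_support d 0 v hv γ hγ).2 (by omega)
  · obtain ⟨h1, h2⟩ := boxLower_support d _ v hv γ hγ
    exact ⟨h1, by omega⟩

end Box

section Degeneration

open Finset Matrix

variable {ι : Type} {K : Type} [Field K]

theorem Box.extend_apply {d : ι → ℕ} (u : Box d → K) (β : Box d) :
    Function.extend Subtype.val u 0 β.1 = u β :=
  Subtype.val_injective.extend_apply u 0 β

theorem Box.extend_of_not {d : ι → ℕ} (u : Box d → K) {α : ι → ℕ} (h : ¬ ∀ i, α i < d i) :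
    Function.extend Subtype.val u 0 α = 0 :=
  Function.extend_apply' _ _ _ fun ⟨β, hβ⟩ => h (hβ ▸ β.2)

theorem Box.extend_injective {d : ι → ℕ} {u : Box d → K}
    (h : Function.extend Subtype.val u 0 = 0) : u = 0 := by
  funext β
  rw [← Box.extend_apply u β, h]
  rfl

variable [Fintype ι]

/-- The matrix of multiplication by `∑ z_i` on the monomial basis of `K[z]/(z_i ^ d_i)`. -/
def IsBoxMatrix (d : ι → ℕ) (N : Matrix (Box d) (Box d) K) : Prop := by
  classical
  exact ∀ γ β : Box d, N γ β = ∑ i, if γ.1 = β.1 + Pi.single i 1 then 1 else 0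

theorem Box.extend_mem_boxPiece {d : ι → ℕ} {u : Box d → K} {k : ℕ}
    (hu : ∀ β, u β ≠ 0 → expDegree β.1 = k) :
    Function.extend Subtype.val u 0 ∈ boxPiece K d k := by
  intro α hα
  by_cases h : ∀ i, α i < d i
  · exact ⟨h, hu ⟨α, h⟩ (by rwa [← Box.extend_apply u])⟩
  · exact absurd (Box.extend_of_not u h) hα

theorem IsBoxMatrix.extend_mulVec {d : ι → ℕ} {N : Matrix (Box d) (Box d) K}
    (hN : IsBoxMatrix d N) (u : Box d → K) :
    Function.extend Subtype.val (N *ᵥ u) 0 =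
      boxRaise K d (Function.extend Subtype.val u 0) := by
  classical
  funext α
  by_cases hα : ∀ i, α i < d i
  · have hl : Function.extend Subtype.val (N *ᵥ u) 0 α = (N *ᵥ u) ⟨α, hα⟩ :=
      Box.extend_apply (N *ᵥ u) ⟨α, hα⟩
    rw [hl]
    have : (N *ᵥ u) ⟨α, hα⟩ =
        ∑ i, ∑ β : Box d, (if α = β.1 + Pi.single i 1 then 1 else 0) * u β := by
      rw [sum_comm, mulVec, dotProduct]
      refine sum_congr rfl fun β _ => ?_
      rw [← sum_mul, hN ⟨α, hα⟩ β]
    rw [this]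
    refine sum_congr rfl fun i _ => ?_
    split_ifs with h
    · have hm : ∀ j, (α - Pi.single i 1 : ι → ℕ) j < d j := fun j =>
        lt_of_le_of_lt (Nat.sub_le _ _) (hα j)
      have he : Function.extend Subtype.val u 0 (α - Pi.single i 1) = u ⟨_, hm⟩ :=
        Box.extend_apply u ⟨_, hm⟩
      rw [he, sum_eq_single ⟨_, hm⟩]
      · rw [if_pos (sub_single_add_single h.1).symm, one_mul]
      · intro β _ hβ
        rw [if_neg, zero_mul]
        rintro rfl
        exact hβ (Subtype.ext (by simp))
      · simp
    · refine sum_eq_zero fun β _ => ?_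
      rw [if_neg, zero_mul]
      rintro rfl
      exact h ⟨by simp, hα i⟩
  · rw [Box.extend_of_not _ hα]
    symm
    refine sum_eq_zero fun i _ => ?_
    split_ifs with h
    · refine Box.extend_of_not u fun h' => hα fun j => ?_
      rcases eq_or_ne j i with rfl | hj
      · exact h.2
      · simpa [hj] using h' j
    · rfl

theorem IsBoxMatrix.extend_pow_mulVec {d : ι → ℕ} {N : Matrix (Box d) (Box d) K}
    [DecidableEq (Box d)] (hN : IsBoxMatrix d N) (m : ℕ) (u : Box d → K) :
    Function.extend Subtype.val (N ^ m *ᵥ u) 0 =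
      (boxRaise K d ^ m) (Function.extend Subtype.val u 0) := by
  induction m with
  | zero => simp
  | succ m ih =>
    rw [pow_succ', ← mulVec_mulVec, hN.extend_mulVec, ih, pow_succ', Module.End.mul_apply]

theorem IsBoxMatrix.degree_eq {d : ι → ℕ} {N : Matrix (Box d) (Box d) K}
    [DecidableEq (Box d)] (hN : IsBoxMatrix d N) {m : ℕ} {γ β : Box d} (h : (N ^ m) γ β ≠ 0) :
    expDegree γ.1 = expDegree β.1 + m := by
  have h1 : Function.extend Subtype.val (Pi.single β (1 : K)) 0 ∈
      boxPiece K d (expDegree β.1) := by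
    refine Box.extend_mem_boxPiece fun β' hβ' => ?_
    rw [Pi.single_apply] at hβ'
    by_contra hne
    exact hβ' (if_neg fun h => hne (by rw [h]))
  have h2 := boxRaise_pow_mem d _ m _ h1
  rw [← hN.extend_pow_mulVec] at h2
  refine (h2 γ.1 ?_).2
  rw [Box.extend_apply, mulVec_single_one]
  exact h

theorem IsBoxMatrix.pow_mulVec_injective [CharZero K] {d : ι → ℕ} (hd : ∀ i, 1 ≤ d i)
    {N : Matrix (Box d) (Box d) K} [DecidableEq (Box d)] (hN : IsBoxMatrix d N) {i k : ℕ}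
    (hik : 2 * i + k = ∑ i, (d i - 1)) {u : Box d → K}
    (hu : ∀ β, u β ≠ 0 → expDegree β.1 = i) (h : N ^ k *ᵥ u = 0) : u = 0 := by
  refine Box.extend_injective (eq_zero_of_boxRaise_pow_eq_zero d hd i k hik _
    (Box.extend_mem_boxPiece hu) ?_)
  rw [← hN.extend_pow_mulVec, h]
  funext α
  by_cases hα : ∀ i, α i < d i
  · exact Box.extend_apply 0 ⟨α, hα⟩
  · exact Box.extend_of_not _ hα

open Classical in
/-- A square matrix which is non-singular precisely when the powers of `P` are injective from
each graded piece of degree `i ≤ c / 2` to the graded piece of degree `c - i`. -/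
noncomputable def lefschetzMatrix {A : Type*} [CommRing A] (d : ι → ℕ)
    (P : Matrix (Box d) (Box d) A) : Matrix (Box d) (Box d) A :=
  fun γ β => if 2 * expDegree β.1 ≤ ∑ i, (d i - 1) then
    (P ^ (∑ i, (d i - 1) - 2 * expDegree β.1)) γ.rev β else if γ = β then 1 else 0

theorem lefschetzMatrix_map {A A' : Type*} [CommRing A] [CommRing A'] (φ : A →+* A') (d : ι → ℕ)
    (P : Matrix (Box d) (Box d) A) :
    φ.mapMatrix (lefschetzMatrix d P) = lefschetzMatrix d (φ.mapMatrix P) := by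
  ext γ β
  simp only [lefschetzMatrix, RingHom.mapMatrix_apply, map_apply]
  split_ifs with h1 h2
  · rw [← RingHom.mapMatrix_apply, ← map_pow]
    rfl
  · exact map_one φ
  · exact map_zero φ

open Classical in
theorem IsBoxMatrix.lefschetzMatrix_det_ne_zero [CharZero K] {d : ι → ℕ} (hd : ∀ i, 1 ≤ d i)
    {N : Matrix (Box d) (Box d) K} (hN : IsBoxMatrix d N) : (lefschetzMatrix d N).det ≠ 0 := by
  intro hdet
  obtain ⟨u, hu, h⟩ := exists_mulVec_eq_zero_iff.2 hdet
  refine hu ?_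
  set c := ∑ i, (d i - 1) with hc
  have hlow : ∀ β : Box d, 2 * expDegree β.1 ≤ c → u β = 0 := by
    intro β hβ
    obtain ⟨k, hk⟩ := Nat.exists_eq_add_of_le hβ
    have key := hN.pow_mulVec_injective hd (i := expDegree β.1) (k := k) hk.symm
      (u := fun β' => if expDegree β'.1 = expDegree β.1 then u β' else 0)
      (fun β' h' => by by_contra hne; exact h' (if_neg hne)) ?_
    · simpa using congrFun key β
    funext γ
    have hγ := γ.degree_rev
    by_cases hdeg : expDegree γ.1 = expDegree β.1 + k
    · have hrow := congrFun h γ.rev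
      refine Eq.trans ?_ hrow
      refine sum_congr rfl fun β' _ => ?_
      simp only [lefschetzMatrix, Box.rev_rev]
      by_cases h1 : 2 * expDegree β'.1 ≤ ∑ i, (d i - 1)
      · rw [if_pos h1]
        by_cases h2 : expDegree β'.1 = expDegree β.1
        · rw [if_pos h2, h2]
          have h3 : ∑ i, (d i - 1) - 2 * expDegree β.1 = k := by omega
          rw [h3]
        · rw [if_neg h2, mul_zero]
          by_cases h0 : (N ^ (∑ i, (d i - 1) - 2 * expDegree β'.1)) γ β' = 0
          · rw [h0, zero_mul]
          · have := hN.degree_eq h0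
            omega
      · have h2 : expDegree β'.1 ≠ expDegree β.1 := by omega
        have h3 : γ.rev ≠ β' := by
          rintro rfl
          omega
        rw [if_neg h1, if_neg h2, if_neg h3, mul_zero, zero_mul]
    · refine sum_eq_zero fun β' _ => ?_
      dsimp only
      split_ifs with h1
      · by_cases h0 : (N ^ k) γ β' = 0
        · rw [h0, zero_mul]
        · have := hN.degree_eq h0
          omega
      · rw [mul_zero]
  funext β
  by_cases hβ : 2 * expDegree β.1 ≤ c
  · exact hlow β hβ
  have hrow := congrFun h β
  rw [mulVec, dotProduct, sum_eq_single β] at hrow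
  · simpa [lefschetzMatrix, ← hc, hβ] using hrow
  · intro β' _ hne
    by_cases hβ' : 2 * expDegree β'.1 ≤ c
    · rw [hlow β' hβ', mul_zero]
    · simp [lefschetzMatrix, ← hc, hβ', hne.symm]
  · simp

theorem lefschetzMatrix_mulVec_eq_zero {d : ι → ℕ} [DecidableEq (Box d)]
    {P : Matrix (Box d) (Box d) K} {i : ℕ} (hi : 2 * i ≤ ∑ i, (d i - 1)) {u : Box d → K}
    (hu : ∀ β, u β ≠ 0 → expDegree β.1 = i) (h : P ^ (∑ i, (d i - 1) - 2 * i) *ᵥ u = 0) :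
    lefschetzMatrix d P *ᵥ u = 0 := by
  funext γ
  have hrow := congrFun h γ.rev
  refine Eq.trans ?_ hrow
  refine sum_congr rfl fun β _ => ?_
  by_cases h0 : u β = 0
  · rw [h0, mul_zero, mul_zero]
  · have := hu β h0
    simp only [lefschetzMatrix, this, if_pos hi]
    congr!

end Degeneration

section Straightening

open Finset Matrix

variable {ι : Type} [Fintype ι] {K : Type} [Field K] {E : Type} [CommRing E] [Algebra K E]

/-- The span of the monomials in `z` of degree `k` and weight at least `m`. -/
def monSpan (K : Type) [Field K] {E : Type} [CommRing E] [Algebra K E] (z : ι → E) (w : ι → ℕ)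
    (k m : ℕ) : Submodule K E :=
  Submodule.span K ((fun α : ι → ℕ => ∏ i, z i ^ α i) '' {α | expDegree α = k ∧ m ≤ expWeight w α})

theorem prod_pow_mem_monSpan (z : ι → E) (w : ι → ℕ) {k m : ℕ} {α : ι → ℕ}
    (hk : expDegree α = k) (hm : m ≤ expWeight w α) : ∏ i, z i ^ α i ∈ monSpan K z w k m :=
  Submodule.subset_span ⟨α, ⟨hk, hm⟩, rfl⟩

theorem prod_pow_single [DecidableEq ι] (z : ι → E) (i : ι) (m : ℕ) :
    ∏ j, z j ^ (Pi.single i m : ι → ℕ) j = z i ^ m := by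
  rw [prod_eq_single i] <;> simp +contextual

theorem prod_pow_add (z : ι → E) (α β : ι → ℕ) :
    ∏ j, z j ^ (α + β) j = (∏ j, z j ^ α j) * ∏ j, z j ^ β j := by
  simp [pow_add, prod_mul_distrib]

theorem mem_monSpan_one (z : ι → E) (w : ι → ℕ) {m : ℕ} {i : ι} (hm : m ≤ w i) :
    z i ∈ monSpan K z w 1 m := by
  classical
  have := prod_pow_mem_monSpan (K := K) z w (α := Pi.single i 1) (expDegree_single i 1)
    (m := m) (by simpa [expWeight_single] using hm)
  simpa [prod_pow_single] using this

theorem one_mem_monSpan (z : ι → E) (w : ι → ℕ) : (1 : E) ∈ monSpan K z w 0 0 := by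
  have := prod_pow_mem_monSpan (K := K) z w (α := 0) (k := 0) (by simp [expWeight]) (Nat.zero_le _)
  simpa using this

theorem monSpan_mono (z : ι → E) (w : ι → ℕ) (k : ℕ) {m m' : ℕ} (h : m ≤ m') :
    monSpan K z w k m' ≤ monSpan K z w k m :=
  Submodule.span_mono (Set.image_mono fun _ hα => ⟨hα.1, h.trans hα.2⟩)

theorem mul_mem_monSpan (z : ι → E) (w : ι → ℕ) {k k' m m' : ℕ} {x y : E}
    (hx : x ∈ monSpan K z w k m) (hy : y ∈ monSpan K z w k' m') :
    x * y ∈ monSpan K z w (k + k') (m + m') := by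
  have h := Submodule.mul_mem_mul hx hy
  rw [monSpan, monSpan, Submodule.span_mul_span] at h
  refine Submodule.span_mono ?_ h
  rintro _ ⟨_, ⟨α, hα, rfl⟩, _, ⟨β, hβ, rfl⟩, rfl⟩
  refine ⟨α + β, ⟨?_, ?_⟩, prod_pow_add z α β⟩
  · rw [expDegree_add, hα.1, hβ.1]
  · rw [expWeight_add]
    exact add_le_add hα.2 hβ.2

theorem pow_mem_monSpan (z : ι → E) (w : ι → ℕ) {k m : ℕ} {x : E}
    (hx : x ∈ monSpan K z w k m) (l : ℕ) : x ^ l ∈ monSpan K z w (l * k) (l * m) := by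
  induction l with
  | zero => simpa using one_mem_monSpan z w
  | succ l ih =>
    rw [pow_succ, Nat.succ_mul, Nat.succ_mul]
    exact mul_mem_monSpan z w ih hx

/-- If each `z i ^ d i` is a combination of monomials of the same degree and larger weight, then
every monomial is a combination of box monomials of the same degree and at least its weight. -/
theorem monSpan_le_span_box (z : ι → E) (w d : ι → ℕ)
    (hz : ∀ i, z i ^ d i ∈ monSpan K z w (d i) (w i * d i + 1)) (k m : ℕ) :
    monSpan K z w k m ≤ Submodule.span K
      ((fun β : Box d => ∏ i, z i ^ β.1 i) '' {β | expDegree β.1 = k ∧ m ≤ expWeight w β.1}) := by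
  classical
  obtain ⟨M, hM⟩ : ∃ M, ∀ α : ι → ℕ, expDegree α = k → expWeight w α ≤ M := by
    refine ⟨(∑ i, w i) * k, fun α hα => ?_⟩
    rw [← hα, expDegree, expWeight, expWeight, mul_sum]
    refine sum_le_sum fun i _ => ?_
    rw [Pi.one_apply, one_mul]
    exact Nat.mul_le_mul_right _ (single_le_sum (f := w) (fun _ _ => Nat.zero_le _) (mem_univ i))
  induction h : M + 1 - m generalizing m with
  | zero =>
    refine Submodule.span_le.2 ?_
    rintro _ ⟨α, hα, rfl⟩
    have := hM α hα.1
    have := hα.2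
    omega
  | succ n ih =>
    refine Submodule.span_le.2 ?_
    rintro _ ⟨α, hα, rfl⟩
    by_cases hbox : ∀ i, α i < d i
    · exact Submodule.subset_span ⟨⟨α, hbox⟩, hα, rfl⟩
    push Not at hbox
    obtain ⟨i, hi⟩ := hbox
    have hα' : (α - Pi.single i (d i)) + Pi.single i (d i) = α := by
      funext j
      rcases eq_or_ne j i with rfl | hj
      · simp [hi]
      · simp [hj]
    have h1 := mul_mem_monSpan z w
      (prod_pow_mem_monSpan (K := K) z w (α := α - Pi.single i (d i)) rfl le_rfl) (hz i)
    rw [← prod_pow_single z i (d i), ← prod_pow_add, hα'] at h1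
    have h2 : expDegree (α - Pi.single i (d i)) + d i = k := by
      rw [← hα.1]
      conv_rhs => rw [← hα', expDegree_add, expDegree_single]
    have h3 : expWeight w (α - Pi.single i (d i)) + (w i * d i + 1) = expWeight w α + 1 := by
      conv_rhs => rw [← hα', expWeight_add, expWeight_single]
      ring
    rw [h2, h3] at h1
    have h4 : m + 1 ≤ expWeight w α + 1 := Nat.succ_le_succ hα.2
    have hsub : {β : Box d | expDegree β.1 = k ∧ m + 1 ≤ expWeight w β.1} ⊆
        {β : Box d | expDegree β.1 = k ∧ m ≤ expWeight w β.1} :=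
      fun β hβ => ⟨hβ.1, (Nat.le_succ m).trans hβ.2⟩
    exact Submodule.span_mono (Set.image_mono hsub)
      (ih (m + 1) (by omega) (monSpan_mono z w k h4 h1))

/-- If multiplication by the generators `z i` is, up to terms of larger weight, the same as for a
monomial complete intersection, then a generic linear form is a strong Lefschetz element
(injectivity part). -/
theorem exists_strongLefschetz_of_basis [CharZero K] (z : ι → E) (w d : ι → ℕ)
    (hd : ∀ i, 1 ≤ d i) (b : Module.Basis (Box d) K E) (hb : ∀ β, b β = ∏ i, z i ^ β.1 i)
    (hz : ∀ i, z i ^ d i ∈ monSpan K z w (d i) (w i * d i + 1)) :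
    ∃ t : K, ∀ i, 2 * i ≤ ∑ i, (d i - 1) → ∀ v,
      (∀ β, b.repr v β ≠ 0 → expDegree β.1 = i) →
      (∑ i, t ^ w i • z i) ^ (∑ i, (d i - 1) - 2 * i) * v = 0 → v = 0 := by
  classical
  have hrepr : ∀ k m, ∀ v ∈ monSpan K z w k m, ∀ γ, b.repr v γ ≠ 0 → m ≤ expWeight w γ.1 := by
    intro k m v hv γ hγ
    have h1 := monSpan_le_span_box z w d hz k m hv
    have h2 : (fun β : Box d => ∏ i, z i ^ β.1 i) = b := funext fun β => (hb β).symm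
    rw [h2, Module.Basis.mem_span_image] at h1
    exact (h1 (Finsupp.mem_support_iff.2 hγ)).2
  have hmono : ∀ (i : ι) (β : Box d),
      z i * b β = ∏ j, z j ^ (β.1 + Pi.single i 1 : ι → ℕ) j := fun i β => by
    rw [prod_pow_add, prod_pow_single, hb, pow_one, mul_comm]
  have hstep : ∀ (i : ι) (β γ : Box d), b.repr (z i * b β) γ ≠ 0 → γ.1 ≠ β.1 + Pi.single i 1 →
      expWeight w β.1 + w i < expWeight w γ.1 := by
    intro i β γ hγ hne
    rw [hmono] at hγ
    by_cases hbox : ∀ j, (β.1 + Pi.single i 1 : ι → ℕ) j < d j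
    · have h1 : b ⟨_, hbox⟩ = ∏ j, z j ^ (β.1 + Pi.single i 1 : ι → ℕ) j := hb _
      rw [← h1, b.repr_self, Finsupp.single_apply, if_neg] at hγ
      · exact absurd rfl hγ
      · rintro rfl
        exact hne rfl
    · have hbi : β.1 i + 1 = d i := by
        by_contra hni
        refine hbox fun j => ?_
        rcases eq_or_ne j i with rfl | hj
        · have := β.2 j
          simp only [Pi.add_apply, Pi.single_eq_same]
          omega
        · simpa [hj] using β.2 j
      have hsplit : β.1 + Pi.single i 1 = (β.1 - Pi.single i (β.1 i)) + Pi.single i (d i) := by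
        funext j
        rcases eq_or_ne j i with rfl | hj
        · simp [hbi]
        · simp [hj]
      have h1 := mul_mem_monSpan z w
        (prod_pow_mem_monSpan (K := K) z w (α := β.1 - Pi.single i (β.1 i)) rfl le_rfl) (hz i)
      rw [← prod_pow_single z i (d i), ← prod_pow_add, ← hsplit] at h1
      have h2 := hrepr _ _ _ h1 γ hγ
      have h3 : expWeight w (β.1 + Pi.single i 1) =
          expWeight w (β.1 - Pi.single i (β.1 i)) + w i * d i := by
        rw [hsplit, expWeight_add, expWeight_single]
      rw [expWeight_add, expWeight_single] at h3
      omega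
  let P : Matrix (Box d) (Box d) (Polynomial K) := fun γ β => ∑ i,
    Polynomial.C (b.repr (z i * b β) γ) *
      Polynomial.X ^ (expWeight w γ.1 - (expWeight w β.1 + w i))
  have hP : ∀ (s : K) (γ β : Box d), (Polynomial.evalRingHom s).mapMatrix P γ β =
      ∑ i, b.repr (z i * b β) γ * s ^ (expWeight w γ.1 - (expWeight w β.1 + w i)) := by
    intro s γ β
    change Polynomial.eval s (∑ i, _) = _
    simp [Polynomial.eval_finsetSum]
  have hP0 : IsBoxMatrix d ((Polynomial.evalRingHom (0 : K)).mapMatrix P) := by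
    intro γ β
    rw [hP]
    refine sum_congr rfl fun i _ => ?_
    split_ifs with h
    · rw [hmono, ← h, ← hb, b.repr_self, Finsupp.single_eq_same, h, expWeight_add,
        expWeight_single]
      simp
    · by_cases h0 : b.repr (z i * b β) γ = 0
      · rw [h0, zero_mul]
      · have := hstep i β γ h0 h
        rw [zero_pow (by omega), mul_zero]
  have hdet0 := hP0.lefschetzMatrix_det_ne_zero hd
  rw [← lefschetzMatrix_map, ← RingHom.map_det] at hdet0
  obtain ⟨s, hs⟩ : ∃ s, Polynomial.eval s (Polynomial.X * (lefschetzMatrix d P).det) ≠ 0 := by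
    by_contra! hall
    have : Polynomial.X * (lefschetzMatrix d P).det = 0 :=
      Polynomial.funext fun r => by rw [hall r, Polynomial.eval_zero]
    rcases mul_eq_zero.1 this with h | h
    · exact Polynomial.X_ne_zero h
    · rw [h, map_zero] at hdet0
      exact hdet0 rfl
  rw [Polynomial.eval_mul, Polynomial.eval_X] at hs
  have hs0 : s ≠ 0 := left_ne_zero_of_mul hs
  have hdet : (lefschetzMatrix d ((Polynomial.evalRingHom s).mapMatrix P)).det ≠ 0 := by
    rw [← lefschetzMatrix_map, ← RingHom.map_det]
    exact right_ne_zero_of_mul hs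
  set Q := (Polynomial.evalRingHom s).mapMatrix P with hQ
  have hQe : ∀ γ β, Q γ β =
      ∑ i, b.repr (z i * b β) γ * s ^ (expWeight w γ.1 - (expWeight w β.1 + w i)) := hP s
  refine ⟨s⁻¹, fun i hi v hv h => ?_⟩
  set g := ∑ i, s⁻¹ ^ w i • z i with hg
  let A : E → Box d → K := fun v γ => s ^ expWeight w γ.1 * b.repr v γ
  have hA : ∀ v, A (g * v) = Q *ᵥ A v := by
    intro v
    funext γ
    have h1 : g * v = ∑ β, ∑ i, (b.repr v β * s⁻¹ ^ w i) • (z i * b β) := by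
      conv_lhs => rw [← b.sum_repr v]
      rw [mul_sum]
      refine sum_congr rfl fun β _ => ?_
      rw [hg, sum_mul]
      refine sum_congr rfl fun i _ => ?_
      rw [smul_mul_smul_comm, mul_comm (b.repr v β)]
    simp only [A, h1, map_sum, map_smul, Finsupp.coe_finsetSum, Finset.sum_apply, mulVec,
      dotProduct, hQe, mul_sum, sum_mul, Finsupp.smul_apply, smul_eq_mul]
    refine sum_congr rfl fun β _ => sum_congr rfl fun i _ => ?_
    by_cases h0 : b.repr (z i * b β) γ = 0
    · simp [h0]
    · have hle : expWeight w β.1 + w i ≤ expWeight w γ.1 := by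
        by_cases hγ : γ.1 = β.1 + Pi.single i 1
        · rw [hγ, expWeight_add, expWeight_single, mul_one]
        · exact (hstep i β γ h0 hγ).le
      obtain ⟨n, hn⟩ := Nat.exists_eq_add_of_le hle
      rw [hn, Nat.add_sub_cancel_left, pow_add, pow_add, inv_pow]
      field_simp
  have hApow : ∀ n v, A (g ^ n * v) = Q ^ n *ᵥ A v := by
    intro n
    induction n with
    | zero => simp
    | succ n ih =>
      intro v
      rw [pow_succ', mul_assoc, hA, ih, pow_succ', mulVec_mulVec]
  have hker := lefschetzMatrix_mulVec_eq_zero (P := Q) hi (u := A v)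
    (fun β hβ => hv β (right_ne_zero_of_mul hβ)) (by
      rw [← hApow, h]
      funext γ
      simp [A])
  by_contra hv0
  refine hdet (exists_mulVec_eq_zero_iff.1 ⟨A v, fun hAv => hv0 ?_, hker⟩)
  refine b.repr.injective (Finsupp.ext fun γ => ?_)
  have := congrFun hAv γ
  simpa [A, hs0] using this

end Straightening

section Tower

open Finset Polynomial

theorem AdjoinRoot.linearIndependent_root_pow {Y : Type} [CommRing Y] {F : Y[X]} (hF : F.Monic)
    {n : ℕ} (hn : F.natDegree = n) :
    LinearIndependent Y (fun i : Fin n => AdjoinRoot.root F ^ (i : ℕ)) := by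
  subst hn
  have h := (AdjoinRoot.powerBasis' hF).basis.linearIndependent
  rw [(AdjoinRoot.powerBasis' hF).coe_basis] at h
  exact h

/-- A generic splitting algebra: a monic polynomial `F` of degree `n` splits as `∏ (X - x i)` over
some algebra in which the monomials `∏ x i ^ β i`, `β i < n - i`, are linearly independent. -/
theorem exists_splitting_algebra (n : ℕ) : ∀ (Y : Type) [CommRing Y] [Nontrivial Y] (F : Y[X]),
    F.Monic → F.natDegree = n → ∃ (E : Type) (_ : CommRing E) (_ : Algebra Y E) (x : Fin n → E),
      F.map (algebraMap Y E) = ∏ i, (X - C (x i)) ∧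
      LinearIndependent Y (fun β : Box (fun i : Fin n => n - i) => ∏ i, x i ^ β.1 i) := by
  induction n with
  | zero =>
    intro Y _ _ F hF hn
    refine ⟨Y, inferInstance, inferInstance, Fin.elim0, ?_, ?_⟩
    · simp [hF.natDegree_eq_zero.1 hn]
    · have : Subsingleton (Box fun i : Fin 0 => 0 - i.1) :=
        ⟨fun β γ => Subtype.ext (Subsingleton.elim _ _)⟩
      refine Fintype.linearIndependent_iff.2 fun g hg β => ?_
      rw [Fintype.sum_subsingleton _ β] at hg
      simpa using hg
  | succ n ih =>
    intro Y _ _ F hF hn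
    have hpow := AdjoinRoot.linearIndependent_root_pow hF hn
    have : Nontrivial (AdjoinRoot F) := ⟨⟨_, _, hpow.ne_zero 0⟩⟩
    have hFm : (F.map (AdjoinRoot.of F)).Monic := hF.map _
    have hroot : (F.map (AdjoinRoot.of F)).IsRoot (AdjoinRoot.root F) := AdjoinRoot.isRoot_root F
    have hmul := mul_divByMonic_eq_iff_isRoot.2 hroot
    have hF1 : (F.map (AdjoinRoot.of F) /ₘ (X - C (AdjoinRoot.root F))).Monic :=
      (monic_X_sub_C _).of_mul_monic_left (hmul.symm ▸ hFm)
    have hn1 : (F.map (AdjoinRoot.of F) /ₘ (X - C (AdjoinRoot.root F))).natDegree = n := by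
      rw [natDegree_divByMonic _ (monic_X_sub_C _), natDegree_X_sub_C, hF.natDegree_map, hn,
        Nat.add_sub_cancel]
    obtain ⟨E, _, _, x, hx, hind⟩ := ih (AdjoinRoot F) _ hF1 hn1
    let : Algebra Y E := ((algebraMap (AdjoinRoot F) E).comp (AdjoinRoot.of F)).toAlgebra
    have : IsScalarTower Y (AdjoinRoot F) E := IsScalarTower.of_algebraMap_eq fun _ => rfl
    refine ⟨E, inferInstance, inferInstance,
      Fin.cons (algebraMap (AdjoinRoot F) E (AdjoinRoot.root F)) x, ?_, ?_⟩
    · rw [Fin.prod_univ_succ]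
      simp only [Fin.cons_zero, Fin.cons_succ]
      rw [← hx, ← Polynomial.map_C, ← Polynomial.map_X (algebraMap (AdjoinRoot F) E),
        ← Polynomial.map_sub, ← Polynomial.map_mul, hmul, Polynomial.map_map]
      rfl
    · have h := linearIndependent_smul hpow hind
      let f : Box (fun i : Fin (n + 1) => n + 1 - i.1) → Fin (n + 1) × Box (fun i : Fin n => n - i) :=
        fun β => (⟨β.1 0, by simpa using β.2 0⟩,
          ⟨fun i => β.1 i.succ, fun i => by have := β.2 i.succ; simpa using this⟩)
      have hf : Function.Injective f := by
        intro β γ hβγ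
        refine Subtype.ext (funext fun i => ?_)
        refine Fin.cases ?_ (fun i => ?_) i
        · exact congrArg (fun p => (p.1 : ℕ)) hβγ
        · exact congrArg (fun p => p.2.1 i) hβγ
      convert h.comp f hf using 1
      funext β
      simp [f, Fin.prod_univ_succ, Algebra.smul_def]

theorem exists_truncated_algebra (K : Type) [Field K] {a : ℕ} (ha : 0 < a) (n : ℕ) :
    ∃ (Y : Type) (_ : CommRing Y) (_ : Algebra K Y) (y : Fin n → Y),
      (∀ i, y i ^ a = 0) ∧ LinearIndependent K (fun β : Box (fun _ : Fin n => a) => ∏ i, y i ^ β.1 i) := by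
  induction n with
  | zero =>
    refine ⟨K, inferInstance, inferInstance, Fin.elim0, fun i => i.elim0, ?_⟩
    have : Subsingleton (Box fun _ : Fin 0 => a) :=
      ⟨fun β γ => Subtype.ext (Subsingleton.elim _ _)⟩
    refine Fintype.linearIndependent_iff.2 fun g hg β => ?_
    rw [Fintype.sum_subsingleton _ β] at hg
    simpa using hg
  | succ n ih =>
    obtain ⟨Y, _, _, y, hy, hind⟩ := ih
    have : Nontrivial Y := ⟨⟨_, _, hind.ne_zero ⟨0, fun _ => ha⟩⟩⟩
    have hpow := AdjoinRoot.linearIndependent_root_pow (monic_X_pow (R := Y) a) (natDegree_X_pow a)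
    set F : Y[X] := X ^ a with hF
    refine ⟨AdjoinRoot F, inferInstance, inferInstance,
      Fin.cons (AdjoinRoot.root F) fun i => AdjoinRoot.of F (y i), ?_, ?_⟩
    · refine Fin.cases ?_ fun i => ?_
      · have := AdjoinRoot.eval₂_root F
        simpa [hF] using this
      · simp [← map_pow, hy]
    · have h := linearIndependent_smul hind hpow
      let f : Box (fun _ : Fin (n + 1) => a) → Box (fun _ : Fin n => a) × Fin a :=
        fun β => (⟨fun i => β.1 i.succ, fun i => β.2 i.succ⟩, ⟨β.1 0, β.2 0⟩)
      have hf : Function.Injective f := by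
        intro β γ hβγ
        refine Subtype.ext (funext fun i => ?_)
        refine Fin.cases ?_ (fun i => ?_) i
        · exact congrArg (fun p => (p.2 : ℕ)) hβγ
        · exact congrArg (fun p => p.1.1 i) hβγ
      convert h.comp f hf using 1
      funext β
      simp [f, Fin.prod_univ_succ, Algebra.smul_def, mul_comm]

/-- The exponent bounds of the monomial basis of `K[y, x]/(y_j ^ a, e_k(x) - e_k(y))`. -/
def coverBound (a n : ℕ) : Fin n ⊕ Fin n → ℕ := Sum.elim (fun _ => a) fun i => n - i

theorem exists_cover_algebra (K : Type) [Field K] {a : ℕ} (ha : 0 < a) (n : ℕ) :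
    ∃ (E : Type) (_ : CommRing E) (_ : Algebra K E) (z : Fin n ⊕ Fin n → E),
      (∀ i, z (Sum.inl i) ^ a = 0) ∧
      ∏ i, (X - C (z (Sum.inl i))) = ∏ i, (X - C (z (Sum.inr i))) ∧
      LinearIndependent K (fun β : Box (coverBound a n) => ∏ i, z i ^ β.1 i) := by
  obtain ⟨Y, _, _, y, hy, hind⟩ := exists_truncated_algebra K ha n
  have : Nontrivial Y := ⟨⟨_, _, hind.ne_zero ⟨0, fun _ => ha⟩⟩⟩
  have hF : (∏ i, (X - C (y i))).Monic := monic_prod_of_monic _ _ fun i _ => monic_X_sub_C _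
  have hn : (∏ i, (X - C (y i))).natDegree = n := by
    rw [natDegree_prod_of_monic _ _ fun i _ => monic_X_sub_C _]
    simp
  obtain ⟨E, _, _, x, hx, hind'⟩ := exists_splitting_algebra n Y _ hF hn
  let : Algebra K E := ((algebraMap Y E).comp (algebraMap K Y)).toAlgebra
  have : IsScalarTower K Y E := IsScalarTower.of_algebraMap_eq fun _ => rfl
  refine ⟨E, inferInstance, inferInstance, Sum.elim (fun i => algebraMap Y E (y i)) x, ?_, ?_, ?_⟩
  · simp [← map_pow, hy]
  · simpa [Polynomial.map_prod] using hx
  · have h := linearIndependent_smul hind hind'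
    let f : Box (coverBound a n) → Box (fun _ : Fin n => a) × Box (fun i : Fin n => n - i) :=
      fun β => (⟨fun i => β.1 (Sum.inl i), fun i => β.2 (Sum.inl i)⟩,
        ⟨fun i => β.1 (Sum.inr i), fun i => β.2 (Sum.inr i)⟩)
    have hf : Function.Injective f := by
      intro β γ hβγ
      refine Subtype.ext (funext ?_)
      rintro (i | i)
      · exact congrArg (fun p => p.1.1 i) hβγ
      · exact congrArg (fun p => p.2.1 i) hβγ
    convert h.comp f hf using 1
    funext β
    simp [f, Algebra.smul_def]

end Tower

section Cover

open Finset Polynomial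

variable {K : Type} [Field K]

theorem prod_X_sub_C_eq_sum_aeval_esymm {n : ℕ} {A : Type} [CommRing A] [Algebra K A]
    (f : Fin n → A) :
    ∏ i, (X - C (f i)) = ∑ j ∈ range (n + 1), (-1) ^ j *
      (C (MvPolynomial.aeval f (MvPolynomial.esymm (Fin n) K j)) * X ^ (n - j)) := by
  have h := Multiset.prod_X_sub_X_eq_sum_esymm (Finset.univ.val.map f)
  simp only [Multiset.map_map, Function.comp_def, Multiset.card_map, card_val, card_univ,
    Fintype.card_fin] at h
  rw [Finset.prod, h]
  simp [MvPolynomial.aeval_esymm_eq_multiset_esymm]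

theorem aeval_eq_aeval_of_prod_eq {n : ℕ} {A : Type} [CommRing A] [Algebra K A]
    {f g : Fin n → A} (h : ∏ i, (X - C (f i)) = ∏ i, (X - C (g i)))
    {p : MvPolynomial (Fin n) K} (hp : p.IsSymmetric) :
    MvPolynomial.aeval f p = MvPolynomial.aeval g p := by
  have hcoeff : ∀ (u : Fin n → A) (k : ℕ), k ≤ n → (∏ i, (X - C (u i))).coeff (n - k) =
      (-1) ^ k * MvPolynomial.aeval u (MvPolynomial.esymm (Fin n) K k) := by
    intro u k hk
    have := Multiset.prod_X_sub_C_coeff (Finset.univ.val.map u) (k := n - k) (by simp)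
    simp only [Multiset.map_map, Function.comp_def, Multiset.card_map, card_val, card_univ,
      Fintype.card_fin, Nat.sub_sub_self hk] at this
    rw [Finset.prod, this, MvPolynomial.aeval_esymm_eq_multiset_esymm]
  have hes : ∀ k, k ≤ n → MvPolynomial.aeval f (MvPolynomial.esymm (Fin n) K k) =
      MvPolynomial.aeval g (MvPolynomial.esymm (Fin n) K k) := by
    intro k hk
    have h1 := hcoeff f k hk
    rw [h, hcoeff g k hk] at h1
    exact ((isUnit_one.neg.pow k).mul_left_cancel h1).symm
  obtain ⟨q, hq⟩ := MvPolynomial.esymmAlgHom_surjective (σ := Fin n) (R := K) (n := n) (by simp)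
    ⟨p, hp⟩
  have hq' : MvPolynomial.aeval (fun i : Fin n => MvPolynomial.esymm (Fin n) K (i + 1)) q = p := by
    rw [← MvPolynomial.esymmAlgHom_apply, hq]
  rw [← hq', ← AlgHom.comp_apply, ← AlgHom.comp_apply, MvPolynomial.comp_aeval,
    MvPolynomial.comp_aeval]
  simp only [hes _ (Nat.succ_le_of_lt (Fin.is_lt _))]

section Weights

variable {D : Type} [CommRing D] [Algebra K D] {ι : Type} [Fintype ι] (z : ι → D) (w : ι → ℕ)

theorem coeff_prod_X_sub_C_mem_monSpan [Nontrivial D] {κ : Type} [DecidableEq κ] (s : Finset κ)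
    (u : κ → D) (m : ℕ) (hu : ∀ j, u j ∈ monSpan K z w 1 m) (l k : ℕ) (h : l + k = #s) :
    (∏ j ∈ s, (X - C (u j))).coeff l ∈ monSpan K z w k (k * m) := by
  induction s using Finset.induction_on generalizing l k with
  | empty =>
    obtain ⟨rfl, rfl⟩ : l = 0 ∧ k = 0 := by simpa using h
    simpa using one_mem_monSpan z w
  | insert j s hj ih =>
    rw [card_insert_of_notMem hj] at h
    have hdeg : (∏ j ∈ s, (X - C (u j))).natDegree = #s := by
      rw [natDegree_prod_of_monic _ _ fun i _ => monic_X_sub_C _]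
      simp
    have hmul : ∀ k, l + k = #s →
        u j * (∏ j ∈ s, (X - C (u j))).coeff l ∈ monSpan K z w (k + 1) ((k + 1) * m) := by
      intro k hk
      have := mul_mem_monSpan z w (hu j) (ih l k hk)
      rwa [add_comm 1 k, show m + k * m = (k + 1) * m by ring] at this
    rw [prod_insert hj, sub_mul, coeff_sub, coeff_C_mul]
    refine Submodule.sub_mem _ ?_ ?_
    · cases l with
      | zero => simp
      | succ l =>
        rw [coeff_X_mul]
        exact ih l k (by omega)
    · cases k with
      | zero =>
        rw [coeff_eq_zero_of_natDegree_lt (by omega), mul_zero]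
        exact zero_mem _
      | succ k => exact hmul k (by omega)

end Weights

/-- The weights used to degenerate `K[y, x]/(y_j ^ a, e_k(x) - e_k(y))` to a monomial complete
intersection. -/
def coverWeight (n : ℕ) : Fin n ⊕ Fin n → ℕ := Sum.elim (fun _ => n) fun i => n - 1 - i

theorem cover_pow_mem_monSpan {D : Type} [CommRing D] [Algebra K D] [Nontrivial D] {a n : ℕ}
    (z : Fin n ⊕ Fin n → D) (hy : ∀ i, z (Sum.inl i) ^ a = 0)
    (hz : ∏ i, (X - C (z (Sum.inl i))) = ∏ i, (X - C (z (Sum.inr i)))) (i : Fin n ⊕ Fin n) :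
    z i ^ coverBound a n i ∈
      monSpan K z (coverWeight n) (coverBound a n i) (coverWeight n i * coverBound a n i + 1) := by
  rcases i with i | i
  · simp [coverBound, hy]
  set w := coverWeight n with hw
  let P : ℕ → D[X] := fun i => ∏ j with i ≤ (j : Fin n).1, (X - C (z (Sum.inr j)))
  have hPmonic : ∀ i, (P i).Monic := fun i => monic_prod_of_monic _ _ fun _ _ => monic_X_sub_C _
  have hPsucc : ∀ i : Fin n, P i = (X - C (z (Sum.inr i))) * P (i + 1) := by
    intro i
    have h : ({j : Fin n | i.1 ≤ j.1} : Finset (Fin n)) =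
        insert i ({j : Fin n | i.1 + 1 ≤ j.1} : Finset (Fin n)) := by
      ext j
      simp only [mem_filter, mem_univ, true_and, mem_insert, Fin.ext_iff]
      omega
    simp only [P]
    rw [h, prod_insert (by simp)]
  have key : ∀ i ≤ n, (P i).natDegree = n - i ∧
      ∀ k l, l + k = n - i → (P i).coeff l ∈ monSpan K z w k (k * (n - i)) := by
    intro i
    induction i with
    | zero =>
      intro _
      have hP0 : P 0 = ∏ j, (X - C (z (Sum.inl j))) := by simp [P, hz]
      rw [hP0]
      refine ⟨?_, fun k l hkl => ?_⟩
      · rw [natDegree_prod_of_monic _ _ fun i _ => monic_X_sub_C _]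
        simp
      · exact coeff_prod_X_sub_C_mem_monSpan z w _ _ _
          (fun j => mem_monSpan_one z w (by simp [hw, coverWeight])) l k (by simpa using hkl)
    | succ i ih =>
      intro hi
      obtain ⟨hdeg, hco⟩ := ih (by omega)
      have hs := hPsucc ⟨i, hi⟩
      simp only at hs
      have hdeg' : (P (i + 1)).natDegree = n - (i + 1) := by
        rw [hs, (monic_X_sub_C _).natDegree_mul (hPmonic _), natDegree_X_sub_C] at hdeg
        omega
      refine ⟨hdeg', fun k => ?_⟩
      induction k with
      | zero =>
        intro l hl
        rw [add_zero, ← hdeg'] at hl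
        rw [hl, (hPmonic _).coeff_natDegree, zero_mul]
        exact one_mem_monSpan z w
      | succ k ihk =>
        intro l hl
        have h1 : (P (i + 1)).coeff l =
            (P i).coeff (l + 1) + z (Sum.inr ⟨i, hi⟩) * (P (i + 1)).coeff (l + 1) := by
          rw [hs, sub_mul, coeff_sub, coeff_X_mul, coeff_C_mul, sub_add_cancel]
        rw [h1]
        refine Submodule.add_mem _ (monSpan_mono z w _ ?_ (hco (k + 1) (l + 1) (by omega))) ?_
        · exact Nat.mul_le_mul_left _ (by omega)
        · have h2 : z (Sum.inr ⟨i, hi⟩) ∈ monSpan K z w 1 (n - (i + 1)) :=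
            mem_monSpan_one z w (by simp only [hw, coverWeight, Sum.elim_inr]; omega)
          have h3 := mul_mem_monSpan z w h2 (ihk (l + 1) (by omega))
          rwa [add_comm 1 k, show n - (i + 1) + k * (n - (i + 1)) = (k + 1) * (n - (i + 1)) by ring]
            at h3
  obtain ⟨hdeg, hco⟩ := key i i.2.le
  have hroot : (P i).eval (z (Sum.inr i)) = 0 := by simp [hPsucc]
  have hlead : (P i).coeff (n - i) = 1 := by rw [← hdeg, (hPmonic _).coeff_natDegree]
  rw [eval_eq_sum_range, hdeg, sum_range_succ, hlead, one_mul] at hroot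
  have hb : coverBound a n (Sum.inr i) = n - i := rfl
  rw [hb, eq_neg_of_add_eq_zero_right hroot]
  refine Submodule.neg_mem _ (Submodule.sum_mem _ fun l hl => ?_)
  obtain ⟨k, hk⟩ := Nat.exists_eq_add_of_lt (mem_range.1 hl)
  have h1 : z (Sum.inr i) ∈ monSpan K z w 1 (w (Sum.inr i)) := mem_monSpan_one z w le_rfl
  have h2 := mul_mem_monSpan z w (hco (k + 1) l (by omega)) (pow_mem_monSpan z w h1 l)
  rw [mul_one, show k + 1 + l = n - i by omega] at h2
  refine monSpan_mono z w _ ?_ h2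
  obtain ⟨v, hv⟩ : ∃ v, n - i.1 = v + 1 := ⟨n - 1 - i, by have := i.2; omega⟩
  have hwv : w (Sum.inr i) = v := by simp only [hw, coverWeight, Sum.elim_inr]; omega
  rw [hwv, hv]
  have : v + 1 = l + k + 1 := by omega
  nlinarith

end Cover

section CoverAlgebra

open Finset MvPolynomial

variable (K : Type) [Field K] (a n : ℕ)

/-- The ideal of `K[y, x]` generated by the `y_j ^ a` and all `p(x) - p(y)`, `p` symmetric. -/
noncomputable def coverIdeal : Ideal (MvPolynomial (Fin n ⊕ Fin n) K) :=
  Ideal.span ((Set.range fun i : Fin n => (X (Sum.inl i) : MvPolynomial (Fin n ⊕ Fin n) K) ^ a) ∪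
    {f | ∃ p : MvPolynomial (Fin n) K, p.IsSymmetric ∧ f = rename Sum.inr p - rename Sum.inl p})

/-- The algebra `K[y, x]/(y_j ^ a, e_k(x) - e_k(y))`. -/
abbrev CoverAlg : Type := MvPolynomial (Fin n ⊕ Fin n) K ⧸ coverIdeal K a n

/-- The generators of `CoverAlg`. -/
noncomputable def CoverAlg.gen (i : Fin n ⊕ Fin n) : CoverAlg K a n := Ideal.Quotient.mk _ (X i)

/-- The degree `k` part of `CoverAlg`. -/
noncomputable def CoverAlg.piece (k : ℕ) : Submodule K (CoverAlg K a n) :=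
  (homogeneousSubmodule (Fin n ⊕ Fin n) K k).map (Ideal.Quotient.mkₐ K (coverIdeal K a n)).toLinearMap

variable {K a n}

theorem X_pow_mem_coverIdeal (i : Fin n) :
    (X (Sum.inl i) : MvPolynomial (Fin n ⊕ Fin n) K) ^ a ∈ coverIdeal K a n :=
  Ideal.subset_span (Or.inl ⟨i, rfl⟩)

theorem rename_sub_mem_coverIdeal {p : MvPolynomial (Fin n) K} (hp : p.IsSymmetric) :
    rename Sum.inr p - rename Sum.inl p ∈ coverIdeal K a n :=
  Ideal.subset_span (Or.inr ⟨p, hp, rfl⟩)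

theorem CoverAlg.mk_eq_aeval (f : MvPolynomial (Fin n ⊕ Fin n) K) :
    Ideal.Quotient.mk (coverIdeal K a n) f = aeval (CoverAlg.gen K a n) f := by
  have h : Ideal.Quotient.mkₐ K (coverIdeal K a n) = aeval (CoverAlg.gen K a n) := by
    ext i
    simp [CoverAlg.gen]
  rw [← h]
  rfl

theorem CoverAlg.aeval_gen_eq {p : MvPolynomial (Fin n) K} (hp : p.IsSymmetric) :
    aeval (fun i => CoverAlg.gen K a n (Sum.inr i)) p =
      aeval (fun i => CoverAlg.gen K a n (Sum.inl i)) p := by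
  have h := Ideal.Quotient.eq.2 (rename_sub_mem_coverIdeal (a := a) hp)
  rw [CoverAlg.mk_eq_aeval, CoverAlg.mk_eq_aeval, aeval_rename, aeval_rename] at h
  exact h

theorem CoverAlg.gen_pow (i : Fin n) : CoverAlg.gen K a n (Sum.inl i) ^ a = 0 := by
  rw [CoverAlg.gen, ← map_pow]
  exact Ideal.Quotient.eq_zero_iff_mem.2 (X_pow_mem_coverIdeal i)

theorem CoverAlg.prod_gen_eq :
    ∏ i, (Polynomial.X - Polynomial.C (CoverAlg.gen K a n (Sum.inl i))) =
      ∏ i, (Polynomial.X - Polynomial.C (CoverAlg.gen K a n (Sum.inr i))) := by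
  rw [prod_X_sub_C_eq_sum_aeval_esymm (K := K), prod_X_sub_C_eq_sum_aeval_esymm (K := K)]
  refine sum_congr rfl fun j _ => ?_
  rw [CoverAlg.aeval_gen_eq (esymm_isSymmetric _ _ _)]

theorem CoverAlg.piece_eq_monSpan (w : Fin n ⊕ Fin n → ℕ) (k : ℕ) :
    CoverAlg.piece K a n k = monSpan K (CoverAlg.gen K a n) w k 0 := by
  apply le_antisymm
  · rintro _ ⟨f, hf, rfl⟩
    have h : (Ideal.Quotient.mkₐ K (coverIdeal K a n)).toLinearMap f =
        aeval (CoverAlg.gen K a n) f := CoverAlg.mk_eq_aeval f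
    rw [h, aeval_def, eval₂_eq']
    refine Submodule.sum_mem _ fun α hα => ?_
    rw [← Algebra.smul_def]
    refine Submodule.smul_mem _ _ (prod_pow_mem_monSpan _ _ ?_ (Nat.zero_le _))
    rw [← hf (mem_support_iff.1 hα), Finsupp.weight_apply, Finsupp.sum_fintype _ _ (by simp)]
    simp [expWeight]
  · refine Submodule.span_le.2 ?_
    rintro _ ⟨α, hα, rfl⟩
    refine ⟨∏ i, X i ^ α i, ?_, ?_⟩
    · have h := IsHomogeneous.prod univ (fun i => (X i : MvPolynomial (Fin n ⊕ Fin n) K) ^ α i) α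
        fun i _ => by simpa using (isHomogeneous_X K i).pow (α i)
      rw [← hα.1]
      simpa [expWeight] using h
    · simp [CoverAlg.gen]

theorem CoverAlg.exists_basis (ha : 0 < a) :
    ∃ b : Module.Basis (Box (coverBound a n)) K (CoverAlg K a n),
      ∀ β, b β = ∏ i, CoverAlg.gen K a n i ^ β.1 i := by
  obtain ⟨E, _, _, z, hy, hz, hind⟩ := exists_cover_algebra K ha n
  have hker : ∀ f ∈ coverIdeal K a n, aeval z f = 0 := by
    intro f hf
    have hle : coverIdeal K a n ≤ RingHom.ker (aeval z) := by
      refine Ideal.span_le.2 ?_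
      rintro _ (⟨i, rfl⟩ | ⟨p, hp, rfl⟩)
      · simp [RingHom.mem_ker, hy]
      · rw [SetLike.mem_coe, RingHom.mem_ker, map_sub, aeval_rename, aeval_rename, sub_eq_zero]
        exact (aeval_eq_aeval_of_prod_eq hz hp).symm
    exact hle hf
  let Φ : CoverAlg K a n →ₐ[K] E := Ideal.Quotient.liftₐ _ (aeval z) hker
  have hΦ : ∀ i, Φ (CoverAlg.gen K a n i) = z i := fun i => by
    change aeval z (X i) = z i
    rw [aeval_X]
  have hind' : LinearIndependent K
      (fun β : Box (coverBound a n) => ∏ i, CoverAlg.gen K a n i ^ β.1 i) := by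
    refine LinearIndependent.of_comp Φ.toLinearMap ?_
    convert hind using 1
    funext β
    simp [hΦ]
  have hpos : ∀ i, 0 < coverBound a n i := by
    rintro (i | i)
    · exact ha
    · simp [coverBound]
  have : Nontrivial (CoverAlg K a n) := ⟨⟨_, _, hind'.ne_zero ⟨0, hpos⟩⟩⟩
  refine ⟨Module.Basis.mk hind' ?_, fun β => by simp⟩
  intro v _
  obtain ⟨f, rfl⟩ := Ideal.Quotient.mk_surjective v
  rw [← sum_homogeneousComponent f, map_sum]
  refine Submodule.sum_mem _ fun k _ => ?_
  have h1 : Ideal.Quotient.mk (coverIdeal K a n) (homogeneousComponent k f) ∈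
      CoverAlg.piece K a n k := ⟨_, homogeneousComponent_isHomogeneous k f, rfl⟩
  rw [CoverAlg.piece_eq_monSpan (coverWeight n)] at h1
  exact Submodule.span_mono (Set.image_subset_range _ _) (monSpan_le_span_box _ _ _
    (cover_pow_mem_monSpan _ CoverAlg.gen_pow CoverAlg.prod_gen_eq) k 0 h1)

/-- The socle degree of `CoverAlg`. -/
def coverTop (a n : ℕ) : ℕ := ∑ i, (coverBound a n i - 1)

theorem CoverAlg.strongLefschetz [CharZero K] (ha : 0 < a) :
    Nontrivial (CoverAlg K a n) ∧ FiniteDimensional K (CoverAlg K a n) ∧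
    (∀ k, coverTop a n < k → CoverAlg.piece K a n k = ⊥) ∧
    ∃ l : MvPolynomial (Fin n) K, l.IsHomogeneous 1 ∧ ∀ i, 2 * i ≤ coverTop a n →
      (∀ v ∈ CoverAlg.piece K a n i,
        Ideal.Quotient.mk (coverIdeal K a n) (rename Sum.inr l) ^ (coverTop a n - 2 * i) * v = 0 →
          v = 0) ∧
      (∀ u ∈ CoverAlg.piece K a n (coverTop a n - i), ∃ v ∈ CoverAlg.piece K a n i,
        Ideal.Quotient.mk (coverIdeal K a n) (rename Sum.inr l) ^ (coverTop a n - 2 * i) * v =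
          u) := by
  obtain ⟨b, hb⟩ := CoverAlg.exists_basis (K := K) (n := n) ha
  have hpos : ∀ i, 0 < coverBound a n i := by
    rintro (i | i)
    · exact ha
    · simp [coverBound]
  have hnon : Nontrivial (CoverAlg K a n) := ⟨⟨_, _, b.ne_zero ⟨0, hpos⟩⟩⟩
  have hfin : FiniteDimensional K (CoverAlg K a n) := b.finiteDimensional_of_finite
  have hz := cover_pow_mem_monSpan (K := K) _ (CoverAlg.gen_pow (K := K) (a := a) (n := n))
    CoverAlg.prod_gen_eq
  have hpiece : ∀ k, CoverAlg.piece K a n k =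
      Submodule.span K (b '' {β | expDegree β.1 = k}) := by
    intro k
    have hbf : (fun β : Box (coverBound a n) => ∏ i, CoverAlg.gen K a n i ^ β.1 i) = b :=
      funext fun β => (hb β).symm
    rw [CoverAlg.piece_eq_monSpan (coverWeight n)]
    apply le_antisymm
    · have h := monSpan_le_span_box _ _ _ hz k 0
      rw [hbf] at h
      simpa using h
    · refine Submodule.span_le.2 ?_
      rintro _ ⟨β, hβ, rfl⟩
      rw [hb]
      exact prod_pow_mem_monSpan _ _ hβ (Nat.zero_le _)
  have hrank : ∀ k, k ≤ coverTop a n → Module.finrank K (CoverAlg.piece K a n k) =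
      Nat.card {β : Box (coverBound a n) // expDegree β.1 = k} := by
    intro k _
    have h := finrank_span_eq_card (b.linearIndependent.comp
      (fun β : {β : Box (coverBound a n) // expDegree β.1 = k} => β.1) Subtype.val_injective)
    rw [Set.range_comp, Subtype.range_coe_subtype, ← hpiece] at h
    rw [h, Nat.card_eq_fintype_card]
  refine ⟨hnon, hfin, fun k hk => ?_, ?_⟩
  · rw [hpiece, Submodule.span_eq_bot]
    rintro _ ⟨β, hβ, rfl⟩
    have h1 := β.degree_rev
    have h2 : expDegree β.1 = k := hβ
    rw [← coverTop] at h1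
    omega
  obtain ⟨t, ht⟩ := exists_strongLefschetz_of_basis _ (coverWeight n) _ hpos b hb hz
  have hsum : ∑ i, CoverAlg.gen K a n (Sum.inl i) = ∑ i, CoverAlg.gen K a n (Sum.inr i) := by
    have h := CoverAlg.aeval_gen_eq (K := K) (a := a) (psum_isSymmetric (Fin n) K 1)
    simpa [psum] using h.symm
  refine ⟨∑ i : Fin n, C (t ^ n + t ^ (n - 1 - i)) * X i, ?_, fun i hi => ?_⟩
  · exact IsHomogeneous.sum _ _ _ fun i _ => (isHomogeneous_X K i).C_mul _
  have hg : Ideal.Quotient.mk (coverIdeal K a n)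
      (rename Sum.inr (∑ i : Fin n, C (t ^ n + t ^ (n - 1 - i)) * X i)) =
        ∑ i, t ^ coverWeight n i • CoverAlg.gen K a n i := by
    rw [CoverAlg.mk_eq_aeval, aeval_rename, Fintype.sum_sum_type]
    simp only [coverWeight, Sum.elim_inl, Sum.elim_inr]
    rw [← smul_sum, hsum, smul_sum, ← sum_add_distrib, map_sum]
    refine sum_congr rfl fun i _ => ?_
    rw [← add_smul, map_mul, aeval_C, aeval_X]
    exact (Algebra.smul_def _ _).symm
  rw [hg]
  set g := ∑ i, t ^ coverWeight n i • CoverAlg.gen K a n i with hg'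
  have hinj : ∀ v ∈ CoverAlg.piece K a n i, g ^ (coverTop a n - 2 * i) * v = 0 → v = 0 := by
    intro v hv
    refine ht i hi v fun β hβ => ?_
    rw [hpiece, Module.Basis.mem_span_image] at hv
    exact hv (Finsupp.mem_support_iff.2 hβ)
  refine ⟨hinj, ?_⟩
  have hmaps : ∀ v ∈ CoverAlg.piece K a n i, LinearMap.mulLeft K (g ^ (coverTop a n - 2 * i)) v ∈
      CoverAlg.piece K a n (coverTop a n - i) := by
    intro v hv
    rw [CoverAlg.piece_eq_monSpan 0] at hv ⊢
    have hgm : g ∈ monSpan K (CoverAlg.gen K a n) 0 1 0 :=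
      Submodule.sum_mem _ fun j _ => Submodule.smul_mem _ _ (mem_monSpan_one _ _ le_rfl)
    have h := mul_mem_monSpan _ _ (pow_mem_monSpan _ _ hgm (coverTop a n - 2 * i)) hv
    rw [mul_one, mul_zero, show coverTop a n - 2 * i + i = coverTop a n - i by omega] at h
    exact h
  have hcard : Module.finrank K (CoverAlg.piece K a n i) =
      Module.finrank K (CoverAlg.piece K a n (coverTop a n - i)) := by
    rw [hrank _ (by omega), hrank _ (by omega)]
    refine Nat.card_congr ⟨fun β => ⟨β.1.rev, ?_⟩, fun β => ⟨β.1.rev, ?_⟩,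
      fun β => Subtype.ext β.1.rev_rev, fun β => Subtype.ext β.1.rev_rev⟩
    all_goals
      have h1 := β.1.degree_rev
      have h2 := β.2
      rw [← coverTop] at h1
      omega
  have hsurj := (LinearMap.injective_iff_surjective_of_finrank_eq_finrank hcard
    (f := (LinearMap.mulLeft K (g ^ (coverTop a n - 2 * i))).restrict hmaps)).1 (by
      refine (injective_iff_map_eq_zero _).2 fun v hv => Subtype.ext (hinj v.1 v.2 ?_)
      exact congrArg Subtype.val hv)
  intro u hu
  obtain ⟨v, hv⟩ := hsurj ⟨u, hu⟩
  exact ⟨v.1, v.2, congrArg Subtype.val hv⟩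

end CoverAlgebra

section MonomialSymmetric

open Finset

theorem sum_embedding_prod_pow_mem {R : Type} [CommRing R] {n a : ℕ} {u : Fin n → R} {I : Ideal R}
    (hI : ∀ m, a ≤ m → ∑ i, u i ^ m ∈ I) (k : ℕ) : ∀ γ : Fin k → ℕ, (∃ j, a ≤ γ j) →
      ∑ f : Fin k ↪ Fin n, ∏ j, u (f j) ^ γ j ∈ I := by
  classical
  induction k with
  | zero => exact fun γ ⟨j, _⟩ => j.elim0
  | succ k ih =>
    intro γ hγ
    have h1 : ∀ (e : Fin k ↪ Fin n), ∑ i : {i // i ∉ Set.range e}, u i.1 ^ γ 0 =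
        ∑ i, u i ^ γ 0 - ∑ j, u (e j) ^ γ 0 := by
      intro e
      have hr : ∑ j, u (e j) ^ γ 0 = ∑ i with i ∈ Set.range e, u i ^ γ 0 := by
        rw [← sum_map univ e fun i => u i ^ γ 0]
        refine sum_congr ?_ fun _ _ => rfl
        ext i
        simp
      rw [hr, ← sum_filter_add_sum_filter_not univ (fun i => i ∈ Set.range e) fun i => u i ^ γ 0,
        add_sub_cancel_left]
      exact (sum_subtype _ (by simp) fun i => u i ^ γ 0).symm
    have h2 : ∑ f : Fin (k + 1) ↪ Fin n, ∏ j, u (f j) ^ γ j =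
        (∑ i, u i ^ γ 0) * (∑ e : Fin k ↪ Fin n, ∏ j, u (e j) ^ γ j.succ) -
          ∑ l, ∑ e : Fin k ↪ Fin n, ∏ j, u (e j) ^ (γ j.succ + Pi.single (M := fun _ => ℕ) l (γ 0) j) := by
      rw [← (Equiv.embeddingFinSucc k (Fin n)).symm.sum_comp, Fintype.sum_sigma, mul_sum, sum_comm,
        ← sum_sub_distrib]
      refine sum_congr rfl fun e _ => ?_
      simp only [Equiv.coe_embeddingFinSucc_symm, Fin.prod_univ_succ, Fin.cons_zero, Fin.cons_succ]
      rw [← sum_mul, h1, sub_mul, sum_mul univ fun j => u (e j) ^ γ 0]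
      congr 1
      refine sum_congr rfl fun l _ => ?_
      simp only [pow_add, prod_mul_distrib]
      rw [mul_comm]
      congr 1
      rw [prod_eq_single l] <;> simp +contextual
    rw [h2]
    by_cases h0 : a ≤ γ 0
    · refine sub_mem (Ideal.mul_mem_right _ _ (hI _ h0)) (sum_mem fun l _ => ih _ ⟨l, ?_⟩)
      simp only [Pi.single_eq_same]
      omega
    · obtain ⟨j, hj⟩ := hγ
      obtain ⟨j, rfl⟩ := Fin.exists_succ_eq.2 (show j ≠ 0 by rintro rfl; exact h0 hj)
      exact sub_mem (Ideal.mul_mem_left _ _ (ih _ ⟨j, hj⟩))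
        (sum_mem fun l _ => ih _ ⟨j, hj.trans (Nat.le_add_right _ _)⟩)

theorem sum_perm_prod_pow_mem {R : Type} [CommRing R] {n a : ℕ} {u : Fin n → R} {I : Ideal R}
    (hI : ∀ m, a ≤ m → ∑ i, u i ^ m ∈ I) {γ : Fin n → ℕ} (hγ : ∃ j, a ≤ γ j) :
    ∑ σ : Equiv.Perm (Fin n), ∏ j, u (σ j) ^ γ j ∈ I := by
  have h := sum_embedding_prod_pow_mem hI n γ hγ
  rw [← (Equiv.embeddingEquivOfFinite (Fin n)).symm.sum_comp] at h
  exact h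

end MonomialSymmetric

section Retract

open Finset MvPolynomial

variable (K : Type) [Field K] (a n : ℕ)

/-- The ideal generated by the power sums of degrees `a, …, a + n - 1`. -/
noncomputable abbrev psumIdeal : Ideal (MvPolynomial (Fin n) K) :=
  Ideal.span (Set.range fun j : Fin n => psum (Fin n) K (a + j))

/-- The transfer `K[y, x] → K[x]`, `f ↦ ∑ σ, f(x ∘ σ, x)`. -/
noncomputable def coverTransfer : MvPolynomial (Fin n ⊕ Fin n) K →ₗ[K] MvPolynomial (Fin n) K :=
  ∑ σ : Equiv.Perm (Fin n), (aeval (Sum.elim (fun i => X (σ i)) X)).toLinearMap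

variable {K a n}

theorem coverTransfer_apply (f : MvPolynomial (Fin n ⊕ Fin n) K) :
    coverTransfer K n f =
      ∑ σ : Equiv.Perm (Fin n), aeval (Sum.elim (fun i => X (σ i)) (X : _ → MvPolynomial (Fin n) K)) f := by
  simp [coverTransfer]

theorem psum_mem_psumIdeal (m : ℕ) (hm : a ≤ m) : psum (Fin n) K m ∈ psumIdeal K a n := by
  induction m using Nat.strong_induction_on with
  | _ m ih =>
    by_cases hlt : m < a + n
    · refine Ideal.subset_span ⟨⟨m - a, by omega⟩, ?_⟩
      simp only [Nat.add_sub_cancel' hm]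
    have h1 : ∀ i : Fin n, ∑ j ∈ range (n + 1),
        (-1) ^ j * esymm (Fin n) K j * (X i : MvPolynomial (Fin n) K) ^ (n - j) = 0 := by
      intro i
      have h := congrArg (Polynomial.eval (X i : MvPolynomial (Fin n) K))
        (prod_X_sub_C_eq_sum_aeval_esymm (K := K) (X : Fin n → MvPolynomial (Fin n) K))
      rw [Polynomial.eval_prod, prod_eq_zero (mem_univ i) (by simp), Polynomial.eval_finsetSum] at h
      rw [h]
      refine sum_congr rfl fun j _ => ?_
      simp [mul_assoc]
    have h2 : ∑ j ∈ range (n + 1), (-1) ^ j * esymm (Fin n) K j * psum (Fin n) K (m - j) = 0 := by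
      simp only [psum, mul_sum]
      rw [sum_comm]
      refine sum_eq_zero fun i _ => ?_
      rw [← zero_mul (X i ^ (m - n)), ← h1 i, sum_mul]
      refine sum_congr rfl fun j hj => ?_
      rw [mul_assoc, mul_assoc, mul_assoc, ← pow_add]
      have := mem_range.1 hj
      congr 4
      omega
    rw [sum_range_succ', esymm_zero, pow_zero, one_mul, one_mul, Nat.sub_zero] at h2
    rw [eq_neg_of_add_eq_zero_right h2]
    refine neg_mem (sum_mem fun j hj => Ideal.mul_mem_left _ _ ?_)
    have := mem_range.1 hj
    exact ih _ (by omega) (by omega)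

theorem coverTransfer_rename_mul (r : MvPolynomial (Fin n) K) (f : MvPolynomial (Fin n ⊕ Fin n) K) :
    coverTransfer K n (rename Sum.inr r * f) = r * coverTransfer K n f := by
  simp only [coverTransfer_apply, map_mul, aeval_rename, mul_sum]
  refine sum_congr rfl fun σ _ => ?_
  rw [Sum.elim_comp_inr, aeval_X_left_apply]

theorem coverTransfer_rename (r : MvPolynomial (Fin n) K) :
    coverTransfer K n (rename Sum.inr r) = r * C (n.factorial : K) := by
  rw [← mul_one (rename _ r), coverTransfer_rename_mul, coverTransfer_apply]
  simp [Fintype.card_perm]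

theorem coverTransfer_isHomogeneous {f : MvPolynomial (Fin n ⊕ Fin n) K} {k : ℕ}
    (hf : f.IsHomogeneous k) : (coverTransfer K n f).IsHomogeneous k := by
  rw [coverTransfer_apply]
  refine IsHomogeneous.sum _ _ _ fun σ _ => ?_
  have h := hf.aeval (Sum.elim (fun i => X (σ i)) (X : _ → MvPolynomial (Fin n) K)) (n := 1) (by
    rintro (i | i)
    · exact isHomogeneous_X _ _
    · exact isHomogeneous_X _ _)
  rwa [one_mul] at h

theorem coverTransfer_mem {f : MvPolynomial (Fin n ⊕ Fin n) K} (hf : f ∈ coverIdeal K a n) :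
    coverTransfer K n f ∈ psumIdeal K a n := by
  suffices h : ∀ c, coverTransfer K n (c * f) ∈ psumIdeal K a n by simpa using h 1
  induction hf using Submodule.span_induction with
  | zero => simp
  | add x y _ _ hx hy =>
    intro c
    rw [mul_add, map_add]
    exact add_mem (hx c) (hy c)
  | smul r x _ hx =>
    intro c
    rw [smul_eq_mul, ← mul_assoc]
    exact hx _
  | mem x hx =>
    intro c
    rcases hx with ⟨i, rfl⟩ | ⟨p, hp, rfl⟩
    · rw [← support_sum_monomial_coeff c, sum_mul, map_sum]
      refine sum_mem fun α _ => ?_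
      have h := sum_perm_prod_pow_mem (a := a) (u := (X : Fin n → MvPolynomial (Fin n) K))
        (fun m hm => psum_mem_psumIdeal (K := K) m hm)
        (γ := fun j => α (Sum.inl j) + Pi.single (M := fun _ => ℕ) i a j) ⟨i, by simp⟩
      have h2 : coverTransfer K n (monomial α (coeff α c) * X (Sum.inl i) ^ a) =
          (C (coeff α c) * ∏ j, X j ^ α (Sum.inr j)) * ∑ σ : Equiv.Perm (Fin n),
            ∏ j, X (σ j) ^ (α (Sum.inl j) + Pi.single (M := fun _ => ℕ) i a j) := by
        rw [coverTransfer_apply, mul_sum]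
        refine sum_congr rfl fun σ _ => ?_
        rw [map_mul, aeval_monomial, Finsupp.prod_fintype _ _ (by simp), Fintype.prod_sum_type]
        simp only [Sum.elim_inl, Sum.elim_inr, pow_add, prod_mul_distrib, map_pow, aeval_X,
          algebraMap_eq]
        have h3 : ∏ j, (X (σ j) : MvPolynomial (Fin n) K) ^ Pi.single (M := fun _ => ℕ) i a j =
            X (σ i) ^ a := by
          rw [prod_eq_single i] <;> simp +contextual
        rw [h3]
        ring
      rw [h2]
      exact Ideal.mul_mem_left _ _ h
    · rw [coverTransfer_apply]
      refine sum_mem fun σ _ => ?_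
      rw [map_mul, map_sub, aeval_rename, aeval_rename, Sum.elim_comp_inr, Sum.elim_comp_inl]
      have h : aeval (fun i => X (σ i)) p = aeval (X : Fin n → MvPolynomial (Fin n) K) p := by
        conv_rhs => rw [← hp σ, aeval_rename]
        rfl
      rw [h, sub_self, mul_zero]
      exact zero_mem _

theorem rename_mem_coverIdeal {r : MvPolynomial (Fin n) K}
    (hr : r ∈ psumIdeal K a n) : rename Sum.inr r ∈ coverIdeal K a n := by
  have hle : psumIdeal K a n ≤ (coverIdeal K a n).comap (rename Sum.inr) := by
    refine Ideal.span_le.2 ?_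
    rintro _ ⟨j, rfl⟩
    rw [SetLike.mem_coe, Ideal.mem_comap,
      ← sub_add_cancel (rename Sum.inr _) (rename Sum.inl (psum (Fin n) K (a + j)))]
    refine add_mem (rename_sub_mem_coverIdeal (psum_isSymmetric _ _ _)) ?_
    rw [psum, map_sum]
    refine sum_mem fun i _ => ?_
    rw [map_pow, rename_X, pow_add]
    exact Ideal.mul_mem_right _ _ (X_pow_mem_coverIdeal i)
  exact hle hr

variable [CharZero K]

theorem mem_of_mul_factorial_mem {I : Ideal (MvPolynomial (Fin n) K)} {r : MvPolynomial (Fin n) K}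
    (h : r * C (n.factorial : K) ∈ I) : r ∈ I := by
  have h1 := Ideal.mul_mem_right (C (n.factorial : K)⁻¹) _ h
  rwa [mul_assoc, ← C_mul, mul_inv_cancel₀ (by exact_mod_cast n.factorial_ne_zero), C_1, mul_one]
    at h1

theorem rename_mem_coverIdeal_iff {r : MvPolynomial (Fin n) K} :
    rename Sum.inr r ∈ coverIdeal K a n ↔ r ∈ psumIdeal K a n := by
  refine ⟨fun h => mem_of_mul_factorial_mem ?_, rename_mem_coverIdeal⟩
  rw [← coverTransfer_rename]
  exact coverTransfer_mem h

theorem psumQuot_isArtinianRing (ha : 0 < a) :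
    IsArtinianRing (MvPolynomial (Fin n) K ⧸ psumIdeal K a n) := by
  obtain ⟨_, hfin, _⟩ := CoverAlg.strongLefschetz (K := K) (n := n) ha
  let Φ : (MvPolynomial (Fin n) K ⧸ psumIdeal K a n) →ₐ[K] CoverAlg K a n :=
    Ideal.quotientMapₐ _ (rename Sum.inr) fun _ => rename_mem_coverIdeal
  have hΦ : Function.Injective Φ.toLinearMap := by
    refine (injective_iff_map_eq_zero _).2 fun v hv => ?_
    obtain ⟨r, rfl⟩ := Ideal.Quotient.mk_surjective v
    exact Ideal.Quotient.eq_zero_iff_mem.2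
      ((rename_mem_coverIdeal_iff).1 (Ideal.Quotient.eq_zero_iff_mem.1 hv))
  have := FiniteDimensional.of_injective Φ.toLinearMap hΦ
  exact IsArtinianRing.of_finite K _

theorem psumQuot_hasSLP (ha : 0 < a) : AlgHasSLP K (quotGrading K n (psumIdeal K a n)) := by
  obtain ⟨hnon, _, htop, l, hl, hlef⟩ := CoverAlg.strongLefschetz (K := K) (n := n) ha
  have hpiece : ∀ {k : ℕ} {r : MvPolynomial (Fin n) K}, r.IsHomogeneous k →
      Ideal.Quotient.mk (coverIdeal K a n) (rename Sum.inr r) ∈ CoverAlg.piece K a n k :=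
    fun hr => ⟨_, hr.rename_isHomogeneous, rfl⟩
  refine ⟨coverTop a n, ⟨fun hbot => ?_, fun i hi => ?_⟩, Ideal.Quotient.mk _ l, ⟨l, hl, rfl⟩,
    fun i hi => ⟨?_, ?_⟩⟩
  · have h1 : Ideal.Quotient.mk (psumIdeal K a n) (l ^ coverTop a n) ∈
        quotGrading K n (psumIdeal K a n) (coverTop a n) :=
      ⟨_, by simpa using hl.pow (coverTop a n), rfl⟩
    rw [hbot, Submodule.mem_bot, Ideal.Quotient.eq_zero_iff_mem,
      ← rename_mem_coverIdeal_iff, ← Ideal.Quotient.eq_zero_iff_mem, map_pow, map_pow] at h1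
    have h2 := (hlef 0 (Nat.zero_le _)).1 1 (by
      simpa using hpiece (isHomogeneous_one (Fin n) K)) (by simpa using h1)
    exact one_ne_zero h2
  · rw [eq_bot_iff]
    rintro _ ⟨f, hf, rfl⟩
    have h1 := hpiece hf
    rw [htop i hi, Submodule.mem_bot, Ideal.Quotient.eq_zero_iff_mem,
      rename_mem_coverIdeal_iff] at h1
    exact Ideal.Quotient.eq_zero_iff_mem.2 h1
  · rintro _ ⟨f, hf, rfl⟩ h
    have h1 : l ^ (coverTop a n - 2 * i) * f ∈ psumIdeal K a n :=
      Ideal.Quotient.eq_zero_iff_mem.1 (by rw [map_mul, map_pow]; exact h)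
    rw [← rename_mem_coverIdeal_iff, ← Ideal.Quotient.eq_zero_iff_mem, map_mul, map_mul,
      map_pow, map_pow] at h1
    have h2 := (hlef i hi).1 _ (hpiece hf) h1
    rw [Ideal.Quotient.eq_zero_iff_mem, rename_mem_coverIdeal_iff] at h2
    exact Ideal.Quotient.eq_zero_iff_mem.2 h2
  · rintro _ ⟨f, hf, rfl⟩
    obtain ⟨_, ⟨f', hf', rfl⟩, h1⟩ := (hlef i hi).2 _ (hpiece hf)
    have h2 : rename Sum.inr (l ^ (coverTop a n - 2 * i)) * f' - rename Sum.inr f ∈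
        coverIdeal K a n := by
      refine Ideal.Quotient.eq.1 ?_
      rw [map_mul, map_pow, map_pow]
      exact h1
    have h3 := coverTransfer_mem h2
    rw [map_sub, coverTransfer_rename_mul, coverTransfer_rename] at h3
    refine ⟨_, ⟨coverTransfer K n f' * C (n.factorial : K)⁻¹, ?_, rfl⟩, ?_⟩
    · rw [SetLike.mem_coe, mem_homogeneousSubmodule, mul_comm]
      exact (coverTransfer_isHomogeneous hf').C_mul _
    · change _ = Ideal.Quotient.mk (psumIdeal K a n) f
      refine Eq.trans (b := Ideal.Quotient.mk (psumIdeal K a n)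
        (l ^ (coverTop a n - 2 * i) * (coverTransfer K n f' * C (n.factorial : K)⁻¹))) ?_ ?_
      · have h4 := map_mul (Ideal.Quotient.mk (psumIdeal K a n)) (l ^ (coverTop a n - 2 * i))
          (coverTransfer K n f' * C (n.factorial : K)⁻¹)
        rw [map_pow (Ideal.Quotient.mk (psumIdeal K a n))] at h4
        exact h4.symm
      · refine Ideal.Quotient.eq.2 (mem_of_mul_factorial_mem ?_)
        convert h3 using 1
        rw [sub_mul, mul_assoc, mul_assoc, ← C_mul,
          inv_mul_cancel₀ (by exact_mod_cast n.factorial_ne_zero), C_1, mul_one]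

end Retract

section Regularity

open MvPolynomial

attribute [local instance] MvPolynomial.gradedAlgebra

theorem eq_zero_of_sum_pow_eq_zero {D : Type} [CommRing D] [IsDomain D] [CharZero D] {n a k : ℕ}
    (ha : 0 < a) {y : Fin n → D} (hy : ∀ i, k < i.val → y i = 0)
    (hsum : ∀ j ≤ k, ∑ i, y i ^ (a + j) = 0) (i₀ : Fin n) : y i₀ = 0 := by
  classical
  by_contra h0
  have hi₀ : i₀.val ≤ k := by
    by_contra h
    exact h0 (hy i₀ (not_le.1 h))
  set s : Finset (Fin n) := Finset.univ.filter fun i => i.val ≤ k with hs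
  set V : Finset D := (s.image y).erase (y i₀) with hV
  have hcard : V.card ≤ k := by
    have h1 : y i₀ ∈ s.image y := Finset.mem_image_of_mem y (by simpa [hs] using hi₀)
    have h2 : s.card ≤ k + 1 := by
      rw [← Finset.card_range (k + 1), ← Finset.card_map Fin.valEmbedding]
      refine Finset.card_le_card fun i hi => ?_
      obtain ⟨j, hj, rfl⟩ := Finset.mem_map.1 hi
      simpa [hs, Nat.lt_succ_iff] using hj
    have h3 : V.card = (s.image y).card - 1 := Finset.card_erase_of_mem h1
    have h4 := Finset.card_image_le (s := s) (f := y)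
    omega
  set G : Polynomial D := ∏ v ∈ V, (Polynomial.X - Polynomial.C v) with hG
  have hdeg : G.natDegree ≤ k := by
    rwa [hG, Polynomial.natDegree_finsetProd_X_sub_C_eq_card]
  have heval : ∀ t, G.eval t = ∏ v ∈ V, (t - v) := fun t => by
    rw [hG, Polynomial.eval_prod]
    simp_rw [Polynomial.eval_sub, Polynomial.eval_X, Polynomial.eval_C]
  have hzero : ∑ i, y i ^ a * G.eval (y i) = 0 := by
    have h1 : ∀ i, y i ^ a * G.eval (y i) =
        ∑ j ∈ Finset.range (k + 1), G.coeff j * y i ^ (a + j) := fun i => by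
      rw [Polynomial.eval_eq_sum_range' (Nat.lt_succ_of_le hdeg), Finset.mul_sum]
      exact Finset.sum_congr rfl fun j _ => by ring
    simp_rw [h1]
    rw [Finset.sum_comm]
    refine Finset.sum_eq_zero fun j hj => ?_
    rw [← Finset.mul_sum, hsum j (Nat.lt_succ_iff.1 (Finset.mem_range.1 hj)), mul_zero]
  have hterm : ∀ i, y i ^ a * G.eval (y i) =
      if y i = y i₀ then y i₀ ^ a * G.eval (y i₀) else 0 := fun i => by
    split_ifs with h
    · rw [h]
    · by_cases hik : i.val ≤ k
      · rw [heval, Finset.prod_eq_zero (i := y i), mul_zero]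
        · exact Finset.mem_erase.2 ⟨h, Finset.mem_image_of_mem y (by simpa [hs] using hik)⟩
        · exact sub_self _
      · rw [hy i (not_le.1 hik), zero_pow ha.ne', zero_mul]
  rw [Finset.sum_congr rfl fun i _ => hterm i, ← Finset.sum_filter, Finset.sum_const, smul_eq_zero, mul_eq_zero, heval,
    Finset.prod_eq_zero_iff] at hzero
  rcases hzero with h | h | ⟨v, hv, h⟩
  · rw [Finset.card_eq_zero, Finset.filter_eq_empty_iff] at h
    exact h (Finset.mem_univ i₀) rfl
  · exact h0 (pow_eq_zero_iff ha.ne' |>.1 h)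
  · exact (Finset.mem_erase.1 hv).1 (sub_eq_zero.1 h).symm

section NonzeroDivisor

variable {R : Type} [CommRing R] {I : Ideal R} {x f : R}

theorem exists_sub_mul_mem_of_mem_sup_span {u : R} (h : u ∈ I ⊔ Ideal.span {x}) :
    ∃ v, u - x * v ∈ I := by
  obtain ⟨i, hi, _, hw, rfl⟩ := Submodule.mem_sup.1 h
  obtain ⟨v, rfl⟩ := Ideal.mem_span_singleton'.1 hw
  exact ⟨v, by rwa [mul_comm x, add_sub_cancel_right]⟩

theorem mem_of_pow_mul_mem (hx : ∀ u, x * u ∈ I → u ∈ I) (N : ℕ) :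
    ∀ u, x ^ N * u ∈ I → u ∈ I := by
  induction N with
  | zero => exact fun u hu => by simpa using hu
  | succ N ih => exact fun u hu => ih u (hx _ (by rwa [← mul_assoc, ← pow_succ']))

theorem mem_of_mul_mem_of_pow_mem (hx : ∀ u, x * u ∈ I → u ∈ I) {N : ℕ}
    (hN : x ^ N ∈ I ⊔ Ideal.span {f}) (u : R) (hu : f * u ∈ I) : u ∈ I := by
  obtain ⟨v, hv⟩ := exists_sub_mul_mem_of_mem_sup_span hN
  refine mem_of_pow_mul_mem hx N u ?_
  have h := add_mem (I.mul_mem_right u hv) (I.mul_mem_right v hu)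
  rwa [sub_mul, mul_right_comm f v u, sub_add_cancel] at h

theorem mem_sup_of_mul_mem_sup (hx : ∀ u, x * u ∈ I → u ∈ I)
    (hf : ∀ u, f * u ∈ I ⊔ Ideal.span {x} → u ∈ I ⊔ Ideal.span {x}) (u : R)
    (hu : x * u ∈ I ⊔ Ideal.span {f}) : u ∈ I ⊔ Ideal.span {f} := by
  obtain ⟨v, hv⟩ := exists_sub_mul_mem_of_mem_sup_span hu
  have hfv : f * v ∈ I ⊔ Ideal.span {x} := by
    rw [← sub_sub_cancel (x * u) (f * v)]
    exact sub_mem (Ideal.mem_sup_right (Ideal.mul_mem_right _ _ (Ideal.mem_span_singleton_self x)))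
      (Ideal.mem_sup_left hv)
  obtain ⟨w, hw⟩ := exists_sub_mul_mem_of_mem_sup_span (hf v hfv)
  have h : u - f * w ∈ I := hx _ (by
    convert add_mem hv (I.mul_mem_left f hw) using 1
    ring)
  rw [← sub_add_cancel u (f * w)]
  exact add_mem (Ideal.mem_sup_left h)
    (Ideal.mem_sup_right (Ideal.mul_mem_right _ _ (Ideal.mem_span_singleton_self f)))

theorem exists_sub_pow_mul_mem (hx : ∀ u, x * u ∈ I → u ∈ I)
    (hf : ∀ u, f * u ∈ I ⊔ Ideal.span {x} → u ∈ I ⊔ Ideal.span {x}) {u : R} (hu : f * u ∈ I)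
    (N : ℕ) : ∃ v, f * v ∈ I ∧ u - x ^ N * v ∈ I := by
  induction N with
  | zero => exact ⟨u, hu, by simp⟩
  | succ N ih =>
    obtain ⟨v, hv, huv⟩ := ih
    obtain ⟨w, hw⟩ := exists_sub_mul_mem_of_mem_sup_span (hf v (Ideal.mem_sup_left hv))
    refine ⟨w, hx _ ?_, ?_⟩
    · convert sub_mem hv (I.mul_mem_left f hw) using 1
      ring
    · convert add_mem huv (I.mul_mem_left (x ^ N) hw) using 1
      ring

end NonzeroDivisor

variable {K : Type} [Field K] {n : ℕ}

theorem homogeneousComponent_X_pow_mul {d N : ℕ} (h : d < N) (i : Fin n)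
    (v : MvPolynomial (Fin n) K) : homogeneousComponent d (X i ^ N * v) = 0 := by
  ext e
  rw [coeff_homogeneousComponent, coeff_zero]
  split_ifs with he
  · rw [X_pow_eq_monomial, coeff_monomial_mul', if_neg]
    intro hle
    have h1 := hle i
    rw [Finsupp.single_eq_same] at h1
    have h2 := Finsupp.le_degree i e
    omega
  · rfl

theorem mem_of_mul_mem_of_isHomogeneous {I : Ideal (MvPolynomial (Fin n) K)}
    (hI : I.IsHomogeneous (homogeneousSubmodule (Fin n) K)) {i : Fin n}
    {f : MvPolynomial (Fin n) K} (hx : ∀ u, X i * u ∈ I → u ∈ I)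
    (hf : ∀ u, f * u ∈ I ⊔ Ideal.span {X i} → u ∈ I ⊔ Ideal.span {X i})
    (u : MvPolynomial (Fin n) K) (hu : f * u ∈ I) : u ∈ I := by
  rw [mem_iff_homogeneousComponent_mem hI]
  intro d
  obtain ⟨v, -, hv⟩ := exists_sub_pow_mul_mem hx hf hu (d + 1)
  have h := homogeneousComponent_mem_of_mem hI hv d
  rwa [map_sub, homogeneousComponent_X_pow_mul (Nat.lt_succ_self d), sub_zero] at h

variable (K n) in
/-- The ideal generated by the `k` power sums of degrees `a, …, a + k - 1` and by the variables
`x_i` with `m ≤ i` (counted from zero). -/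
noncomputable def psumVarIdeal (a k m : ℕ) : Ideal (MvPolynomial (Fin n) K) :=
  Ideal.span ((fun j => psum (Fin n) K (a + j)) '' Set.Iio k ∪ X '' {i | m ≤ i.val})

variable {a k m : ℕ}

theorem psumVarIdeal_isHomogeneous :
    (psumVarIdeal K n a k m).IsHomogeneous (homogeneousSubmodule (Fin n) K) := by
  refine Ideal.homogeneous_span _ _ ?_
  rintro _ (⟨j, -, rfl⟩ | ⟨i, -, rfl⟩)
  · exact ⟨a + j, IsHomogeneous.sum _ _ _ fun i _ => isHomogeneous_X_pow i _⟩
  · exact ⟨1, isHomogeneous_X K i⟩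

theorem psumVarIdeal_succ_left :
    psumVarIdeal K n a (k + 1) m =
      psumVarIdeal K n a k m ⊔ Ideal.span {psum (Fin n) K (a + k)} := by
  rw [psumVarIdeal, psumVarIdeal, ← Ideal.span_union, Set.Iio_add_one_eq_Iic, ← Set.Iio_insert,
    Set.image_insert_eq, Set.insert_union, Set.union_singleton]

theorem psumVarIdeal_right (hm : m < n) :
    psumVarIdeal K n a k m = psumVarIdeal K n a k (m + 1) ⊔ Ideal.span {X ⟨m, hm⟩} := by
  have h : {i : Fin n | m ≤ i.val} = insert ⟨m, hm⟩ {i | m + 1 ≤ i.val} := by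
    ext i
    simp only [Set.mem_ofPred_eq, Set.mem_insert_iff, Fin.ext_iff]
    omega
  rw [psumVarIdeal, psumVarIdeal, ← Ideal.span_union, h, Set.image_insert_eq, Set.union_singleton,
    Set.union_insert]

theorem mem_psumVarIdeal_zero_of_X_mul_mem (hm : m < n) (u : MvPolynomial (Fin n) K)
    (hu : X ⟨m, hm⟩ * u ∈ psumVarIdeal K n a 0 (m + 1)) : u ∈ psumVarIdeal K n a 0 (m + 1) := by
  have h0 : psumVarIdeal K n a 0 (m + 1) = Ideal.span (X '' {i : Fin n | m + 1 ≤ i.val}) := by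
    simp [psumVarIdeal]
  rw [h0, mem_ideal_span_X_image] at hu ⊢
  intro e he
  obtain ⟨i, hi, hne⟩ := hu (Finsupp.single ⟨m, hm⟩ 1 + e) (by
    rwa [mem_support_iff, coeff_X_mul, ← mem_support_iff])
  refine ⟨i, hi, ?_⟩
  rwa [Finsupp.add_apply, Finsupp.single_eq_of_ne, zero_add] at hne
  rintro rfl
  exact absurd hi (by simp)

variable [CharZero K]

theorem exists_X_pow_mem_psumVarIdeal (ha : 0 < a) (i : Fin n) :
    ∃ N, X i ^ N ∈ psumVarIdeal K n a (k + 1) (k + 1) := by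
  suffices h : (X i : MvPolynomial (Fin n) K) ∈ (psumVarIdeal K n a (k + 1) (k + 1)).radical from h
  rw [Ideal.radical_eq_sInf, Ideal.mem_sInf]
  rintro P ⟨hle, hP⟩
  have : CharZero (MvPolynomial (Fin n) K ⧸ P) :=
    charZero_of_injective_algebraMap (algebraMap K _).injective
  refine Ideal.Quotient.eq_zero_iff_mem.1 (eq_zero_of_sum_pow_eq_zero (k := k) ha
    (y := fun i => Ideal.Quotient.mk P (X i)) (fun i hi => ?_) (fun j hj => ?_) i)
  · exact Ideal.Quotient.eq_zero_iff_mem.2 (hle (Ideal.subset_span (Or.inr ⟨i, hi, rfl⟩)))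
  · simp_rw [← map_pow]
    rw [← map_sum]
    exact Ideal.Quotient.eq_zero_iff_mem.2
      (hle (Ideal.subset_span (Or.inl ⟨j, Nat.lt_succ_of_le hj, rfl⟩)))

theorem psum_mul_mem_psumVarIdeal (ha : 0 < a)
    (hX : ∀ m (hm : m < n), k ≤ m → ∀ u, X ⟨m, hm⟩ * u ∈ psumVarIdeal K n a k (m + 1) →
      u ∈ psumVarIdeal K n a k (m + 1)) (hm : m < n) (hkm : k ≤ m) :
    ∀ u, psum (Fin n) K (a + k) * u ∈ psumVarIdeal K n a k (m + 1) →
      u ∈ psumVarIdeal K n a k (m + 1) := by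
  induction m, hkm using Nat.le_induction with
  | base =>
    obtain ⟨N, hN⟩ := exists_X_pow_mem_psumVarIdeal (K := K) (k := k) ha ⟨k, hm⟩
    rw [psumVarIdeal_succ_left] at hN
    exact mem_of_mul_mem_of_pow_mem (hX k hm le_rfl) hN
  | succ m hkm ih =>
    refine mem_of_mul_mem_of_isHomogeneous psumVarIdeal_isHomogeneous (hX _ hm (by omega)) ?_
    rw [← psumVarIdeal_right hm]
    exact ih (by omega)

theorem X_mul_mem_psumVarIdeal (ha : 0 < a) (k : ℕ) : ∀ m (hm : m < n), k ≤ m →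
    ∀ u, X ⟨m, hm⟩ * u ∈ psumVarIdeal K n a k (m + 1) → u ∈ psumVarIdeal K n a k (m + 1) := by
  induction k with
  | zero => exact fun m hm _ => mem_psumVarIdeal_zero_of_X_mul_mem hm
  | succ k ih =>
    intro m hm hkm
    obtain ⟨m, rfl⟩ := Nat.exists_eq_succ_of_ne_zero (show m ≠ 0 by omega)
    rw [psumVarIdeal_succ_left]
    refine mem_sup_of_mul_mem_sup (ih _ hm (by omega)) ?_
    rw [← psumVarIdeal_right hm]
    exact psum_mul_mem_psumVarIdeal ha ih (by omega) (by omega)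

variable (K) in
theorem psum_isRegular (hn : 0 < n) (ha : 0 < a) :
    RingTheory.Sequence.IsRegular (MvPolynomial (Fin n) K)
      ((List.range n).map fun j => psum (Fin n) K (a + j)) := by
  refine ⟨⟨fun i hi => ?_⟩, fun h => ?_⟩
  · simp only [List.length_map, List.length_range] at hi
    have hI : (Ideal.ofList (((List.range n).map fun j => psum (Fin n) K (a + j)).take i) •
        (⊤ : Submodule (MvPolynomial (Fin n) K) (MvPolynomial (Fin n) K))) =
        psumVarIdeal K n a i (n - 1 + 1) := by
      rw [smul_eq_mul, Ideal.mul_top, psumVarIdeal, Ideal.ofList]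
      congr 1
      ext p
      have hT : ({i | n - 1 + 1 ≤ i.val} : Set (Fin n)) = ∅ := by
        ext j
        have := j.isLt
        simp only [Set.mem_ofPred_eq, Set.mem_empty_iff_false, iff_false]
        omega
      rw [hT, Set.image_empty, Set.union_empty, ← List.map_take, List.take_range,
        min_eq_left hi.le]
      simp
    rw [hI, isSMulRegular_iff_right_eq_zero_of_smul]
    intro q hq
    obtain ⟨u, rfl⟩ := Submodule.Quotient.mk_surjective _ q
    rw [← Submodule.Quotient.mk_smul, Submodule.Quotient.mk_eq_zero] at hq
    rw [Submodule.Quotient.mk_eq_zero]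
    refine psum_mul_mem_psumVarIdeal ha (X_mul_mem_psumVarIdeal ha i) (by omega) (by omega) u ?_
    simpa using hq
  · have h1 : (1 : MvPolynomial (Fin n) K) ∈
        RingHom.ker (constantCoeff (σ := Fin n) (R := K)) := by
      have h2 : (1 : MvPolynomial (Fin n) K) ∈ Ideal.ofList
          ((List.range n).map fun j => psum (Fin n) K (a + j)) := by
        rw [← Ideal.mul_top (Ideal.ofList _), ← smul_eq_mul, ← h]
        trivial
      refine (Ideal.span_le.2 ?_ : Ideal.ofList _ ≤ _) h2
      intro p hp
      obtain ⟨j, -, rfl⟩ := List.mem_map.1 hp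
      simp [psum, RingHom.mem_ker, show a ≠ 0 by omega]
    simp at h1

end Regularity

/-- Proposition 7.1. Let `K` be a field of characteristic
zero, `R = K[x₁, …, x_n]` the standard graded polynomial ring, `a ≥ 1` and
`I = (p_a, p_{a+1}, …, p_{a+n-1})` the ideal generated by the power sums of the
`n` consecutive degrees `a, …, a+n-1`.  Then `A = R/I` is an Artinian complete
intersection and `A` has the SLP. -/
theorem statement_16 (K : Type) [Field K] [CharZero K] (n : ℕ) (hn : 0 < n)
    (a : ℕ) (ha : 0 < a) :
    RingTheory.Sequence.IsRegular (MvPolynomial (Fin n) K)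
      ((List.range n).map fun j => MvPolynomial.psum (Fin n) K (a + j)) ∧
    IsArtinianRing (MvPolynomial (Fin n) K ⧸
      Ideal.span (Set.range fun j : Fin n => MvPolynomial.psum (Fin n) K (a + j))) ∧
    AlgHasSLP K
      (quotGrading K n
        (Ideal.span (Set.range fun j : Fin n => MvPolynomial.psum (Fin n) K (a + j)))) :=
  ⟨psum_isRegular K hn ha, psumQuot_isArtinianRing ha, psumQuot_hasSLP ha⟩
end

section
/- Let K be a field of characteristic zero, R = K[x_1, ..., x_n] and S = K[e_1, ..., e_n] ⊆ R its subring of symmetric polynomials. Let f ∈ S be homogeneous of degree d such that e_2, e_3, ..., e_n, f is a regular sequence in S (i.e., (e_2, ..., e_n, f) is a complete intersection in S). Then R/(e_2, e_3, ..., e_n, f)R has the SLP. -/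
set_option maxHeartbeats 1000000
set_option synthInstance.maxHeartbeats 400000

open TensorProduct

section GradedLefschetz

open Polynomial

variable {K A : Type} [Field K] [CommRing A] [Algebra K A]

/-- The family `𝒜` is multiplicative and contains `1` in degree zero. -/
structure IsMulFamily (𝒜 : ℤ → Submodule K A) : Prop where
  one_mem : (1 : A) ∈ 𝒜 0
  mul_mem : ∀ {i j : ℤ} {x y : A}, x ∈ 𝒜 i → y ∈ 𝒜 j → x * y ∈ 𝒜 (i + j)

/-- The multiplicative family `𝒜` lives in degrees `0, …, c`, has symmetric dimensions, and
some `l ∈ 𝒜 1` has all its Lefschetz powers `l ^ (c - 2 i)` injective on `𝒜 i`. -/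
structure IsLefschetzFamily (𝒜 : ℤ → Submodule K A) (c : ℤ) : Prop extends
    IsMulFamily 𝒜 where
  eq_bot : ∀ i, i < 0 ∨ c < i → 𝒜 i = ⊥
  finrank_symm : ∀ i, Module.finrank K (𝒜 i) = Module.finrank K (𝒜 (c - i))
  exists_lefschetz : ∃ l ∈ 𝒜 1, ∀ (i : ℤ) (m : ℕ), (m : ℤ) = c - 2 * i →
    ∀ v ∈ 𝒜 i, l ^ m * v = 0 → v = 0

/-- Polynomials over `A` that are homogeneous of degree `k` when the variable has degree one. -/
def homogeneousPolys (𝒜 : ℤ → Submodule K A) (k : ℤ) : Submodule K A[X] where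
  carrier := {p | ∀ j : ℕ, p.coeff j ∈ 𝒜 (k - j)}
  add_mem' hp hq j := by simpa using add_mem (hp j) (hq j)
  zero_mem' j := by simp
  smul_mem' a p hp j := by simpa using (𝒜 (k - j)).smul_mem a (hp j)

variable {𝒜 : ℤ → Submodule K A}

theorem mem_homogeneousPolys {k : ℤ} {p : A[X]} :
    p ∈ homogeneousPolys 𝒜 k ↔ ∀ j : ℕ, p.coeff j ∈ 𝒜 (k - j) := Iff.rfl

theorem monomial_mem_homogeneousPolys {k : ℤ} {j : ℕ} {a : A} (ha : a ∈ 𝒜 (k - j)) :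
    monomial j a ∈ homogeneousPolys 𝒜 k := by
  intro i
  rw [coeff_monomial]
  split_ifs with h
  · rwa [← h]
  · exact zero_mem _

theorem C_mem_homogeneousPolys {k : ℤ} {a : A} (ha : a ∈ 𝒜 k) :
    C a ∈ homogeneousPolys 𝒜 k :=
  monomial_mem_homogeneousPolys (by simpa using ha)

theorem IsMulFamily.X_mem (h : IsMulFamily 𝒜) : (X : A[X]) ∈ homogeneousPolys 𝒜 1 :=
  monomial_mem_homogeneousPolys (by simpa using h.one_mem)

theorem IsMulFamily.isMulFamily_homogeneousPolys (h : IsMulFamily 𝒜) :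
    IsMulFamily (homogeneousPolys 𝒜) where
  one_mem := C_mem_homogeneousPolys h.one_mem
  mul_mem {i j p q} hp hq k := by
    rw [coeff_mul]
    refine sum_mem fun x hx => ?_
    have := h.mul_mem (hp x.1) (hq x.2)
    rwa [show i - x.1 + (j - x.2) = i + j - k by
      rw [← Finset.HasAntidiagonal.mem_antidiagonal.1 hx]; push_cast; ring] at this

theorem IsMulFamily.pow_mem (h : IsMulFamily 𝒜) {x : A} (hx : x ∈ 𝒜 1) (m : ℕ) :
    x ^ m ∈ 𝒜 m := by
  induction m with
  | zero => simpa using h.one_mem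
  | succ m ih => simpa [pow_succ] using h.mul_mem ih hx

/-- Division with remainder by a homogeneous monic polynomial stays homogeneous. -/
theorem IsMulFamily.divByMonic_modByMonic_mem [Nontrivial A] (h : IsMulFamily 𝒜) {g : A[X]}
    (hg : g.Monic)
    (hgh : g ∈ homogeneousPolys 𝒜 g.natDegree) {k : ℤ} {p : A[X]}
    (hp : p ∈ homogeneousPolys 𝒜 k) :
    p /ₘ g ∈ homogeneousPolys 𝒜 (k - g.natDegree) ∧ p %ₘ g ∈ homogeneousPolys 𝒜 k := by
  suffices H : ∀ (N : ℕ) (p : A[X]), p.degree < N → p ∈ homogeneousPolys 𝒜 k →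
      ∃ q ∈ homogeneousPolys 𝒜 (k - g.natDegree), ∃ s ∈ homogeneousPolys 𝒜 k,
        s + g * q = p ∧ s.degree < g.degree by
    obtain ⟨q, hq, s, hs, h1⟩ := H (p.natDegree + 1) p
      (lt_of_le_of_lt degree_le_natDegree (by exact_mod_cast Nat.lt_succ_self _)) hp
    obtain ⟨h2, h3⟩ := div_modByMonic_unique q s hg h1
    rw [h2, h3]
    exact ⟨hq, hs⟩
  intro N
  induction N with
  | zero =>
    intro p hpd hp
    have : p = 0 := by
      rw [← degree_eq_bot]; exact Nat.WithBot.lt_zero_iff.1 (by simpa using hpd)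
    exact ⟨0, zero_mem _, 0, zero_mem _, by simp [this], by
      simpa [bot_lt_iff_ne_bot] using hg.ne_zero⟩
  | succ N ih =>
    intro p hpd hp
    by_cases hlt : p.degree < g.degree
    · exact ⟨0, zero_mem _, p, hp, by simp, hlt⟩
    by_cases hN : p.degree < N
    · exact ih p hN hp
    have hp0 : p ≠ 0 := by rintro rfl; simp at hN
    have hpN : p.degree = N := by
      rw [degree_eq_natDegree hp0] at hpd hN ⊢
      norm_cast at hpd hN ⊢
      omega
    have hle : g.natDegree ≤ p.natDegree := natDegree_le_natDegree (not_lt.1 hlt)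
    set t : A[X] := monomial (p.natDegree - g.natDegree) p.leadingCoeff with ht
    have htm : t ∈ homogeneousPolys 𝒜 (k - g.natDegree) := by
      apply monomial_mem_homogeneousPolys
      have := hp p.natDegree
      rwa [show k - (g.natDegree : ℤ) - ((p.natDegree - g.natDegree : ℕ) : ℤ)
        = k - p.natDegree by push_cast [hle]; ring]
    have hgt : g * t ∈ homogeneousPolys 𝒜 k := by
      simpa using h.isMulFamily_homogeneousPolys.mul_mem hgh htm
    have hlt' : (p - g * t).degree < N := by
      rw [← hpN]
      have := div_wf_lemma ⟨not_lt.1 hlt, hp0⟩ hg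
      rwa [C_mul_X_pow_eq_monomial] at this
    obtain ⟨q, hq, s, hs, h1, h2⟩ := ih (p - g * t) hlt' (sub_mem hp hgt)
    refine ⟨q + t, add_mem hq htm, s, hs, ?_, h2⟩
    rw [mul_add, ← add_assoc, h1]; ring

/-- If `l` is a Lefschetz element of `A`, then `l + X` is a Lefschetz element of `A[X] / X ^ r`. -/
theorem X_pow_dvd_of_lefschetz [CharZero K] {c : ℤ} {l : A}
    (hl : ∀ (i : ℤ) (m : ℕ), (m : ℤ) = c - 2 * i → ∀ v ∈ 𝒜 i, l ^ m * v = 0 → v = 0)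
    (r : ℕ) : ∀ (i : ℤ) (m : ℕ), (m : ℤ) = c + r - 2 * i → ∀ u ∈ homogeneousPolys 𝒜 i,
      (X : A[X]) ^ (r + 1) ∣ (C l + X) ^ m * u → X ^ (r + 1) ∣ u := by
  have hA : ∀ (j : ℕ) (a : A), a * (j + 1) = 0 → a = 0 := by
    intro j a ha
    have : ((j + 1 : ℕ) : K) • a = 0 := by
      rw [Algebra.smul_def, mul_comm]; simpa using ha
    exact (smul_eq_zero.1 this).resolve_left (Nat.cast_ne_zero.2 j.succ_ne_zero)
  have hX : ∀ (s : ℕ) (p : A[X]), X ^ (s + 1) ∣ p → X ^ s ∣ derivative p := by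
    intro s p hp
    rw [X_pow_dvd_iff] at hp ⊢
    intro j hj
    rw [coeff_derivative, hp (j + 1) (by omega), zero_mul]
  induction r with
  | zero =>
    intro i m hm u hu hd
    rw [X_pow_dvd_iff] at hd ⊢
    intro j hj
    obtain rfl : j = 0 := by omega
    refine hl i m (by simpa using hm) _ (by simpa using hu 0) ?_
    simpa [mul_coeff_zero, coeff_zero_eq_eval_zero] using hd 0 hj
  | succ r ih =>
    intro i m hm u hu hd
    set N : A[X] := C l + X
    have hder : derivative N = 1 := by simp [N]
    have hdu : derivative u ∈ homogeneousPolys 𝒜 (i - 1) := by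
      intro j
      rw [coeff_derivative]
      have h1 := hu (j + 1)
      have h2 := (𝒜 (i - (j + 1 : ℕ))).smul_mem ((j + 1 : ℕ) : K) h1
      rw [Algebra.smul_def, mul_comm] at h2
      convert h2 using 2
      · push_cast; ring
      · simp
    have key : X ^ (r + 1) ∣ derivative u ∧ X ^ (r + 1) ∣ u := by
      have hd1 : X ^ (r + 1) ∣ N ^ m * u := (pow_dvd_pow _ (by omega)).trans hd
      have hd2 := hX _ _ hd
      rcases m with _ | m
      · simp only [pow_zero, one_mul] at hd1 hd2
        exact ⟨hd2, hd1⟩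
      rw [derivative_mul, derivative_pow_succ, hder, mul_one] at hd2
      have h3 : X ^ (r + 1) ∣ derivative u := by
        refine ih (i - 1) (m + 2) (by push_cast at hm ⊢; linarith) _ hdu ?_
        refine (dvd_add_right (hd1.mul_left (C ((m : A) + 1)))).1 ?_
        convert hd2.mul_left N using 1
        ring
      refine ⟨h3, ih i m (by push_cast at hm ⊢; linarith) u hu ?_⟩
      have h4 := (dvd_add_left (h3.mul_left (N ^ (m + 1)))).1 hd2
      rw [X_pow_dvd_iff] at h4 ⊢
      intro j hj
      have := h4 j hj
      rw [mul_assoc, coeff_C_mul, mul_comm] at this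
      exact hA _ _ this
    obtain ⟨k1, k2⟩ := key
    rw [X_pow_dvd_iff] at k1 k2 ⊢
    intro j hj
    rcases j with _ | j
    · exact k2 0 (by omega)
    · have := k1 j (by omega)
      rw [coeff_derivative] at this
      exact hA _ _ this

end GradedLefschetz

section Deformation

open Polynomial

variable {K : Type} [Field K]

/-- Injectivity is a generic property in polynomial families of linear maps. -/
theorem finite_setOf_not_injective {V E : Type} [AddCommGroup V] [Module K V]
    [FiniteDimensional K V] [AddCommGroup E] [Module K E] (ψ : K → V →ₗ[K] E)
    (hψ : ∀ (v : V) (φ : E →ₗ[K] K), ∃ p : K[X], ∀ t, φ (ψ t v) = p.eval t)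
    (h0 : Function.Injective (ψ 0)) : {t | ¬ Function.Injective (ψ t)}.Finite := by
  obtain ⟨ρ, hρ⟩ := (ψ 0).exists_leftInverse_of_injective (LinearMap.ker_eq_bot.2 h0)
  let b := Module.finBasis K V
  choose p hp using fun i j => hψ (b j) ((b.coord i) ∘ₗ ρ)
  let M : Matrix _ _ K[X] := Matrix.of p
  have hM : ∀ t, M.det.eval t = LinearMap.det (ρ ∘ₗ ψ t) := by
    intro t
    rw [← LinearMap.det_toMatrix b, ← coe_evalRingHom, RingHom.map_det]
    congr 1
    ext i j
    simpa [M, LinearMap.toMatrix_apply] using (hp i j t).symm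
  have hne : M.det ≠ 0 := by
    intro h
    have := hM 0
    rw [h, hρ, LinearMap.det_id] at this
    simp at this
  classical
  refine (M.det.roots.toFinset.finite_toSet).subset fun t ht => ?_
  simp only [Finset.mem_coe, Multiset.mem_toFinset, mem_roots hne, IsRoot.def]
  by_contra hdet
  rw [hM] at hdet
  have hu := (LinearMap.isUnit_iff_isUnit_det (ρ ∘ₗ ψ t)).2 (isUnit_iff_ne_zero.2 hdet)
  have hinj := ((Module.End.isUnit_iff _).1 hu).1
  rw [LinearMap.coe_comp] at hinj
  exact ht (Function.Injective.of_comp hinj)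

variable {A : Type} [CommRing A] [Algebra K A]

theorem exists_eval_eq_of_map_eval (q : A[X][X]) (φ : A[X] →ₗ[K] K) :
    ∃ p : K[X], ∀ t : K, φ (q.map (evalRingHom (algebraMap K A t))) = p.eval t := by
  induction q using Polynomial.induction_on' with
  | add q₁ q₂ h₁ h₂ =>
    obtain ⟨p₁, h₁⟩ := h₁
    obtain ⟨p₂, h₂⟩ := h₂
    exact ⟨p₁ + p₂, fun t => by simp [h₁, h₂]⟩
  | monomial j a =>
    induction a using Polynomial.induction_on' with
    | add q₁ q₂ h₁ h₂ =>
      obtain ⟨p₁, h₁⟩ := h₁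
      obtain ⟨p₂, h₂⟩ := h₂
      exact ⟨p₁ + p₂, fun t => by rw [map_add, Polynomial.map_add, map_add, h₁, h₂, eval_add]⟩
    | monomial k a =>
      refine ⟨C (φ (monomial j a)) * X ^ k, fun t => ?_⟩
      have : (monomial j (monomial k a) : A[X][X]).map (evalRingHom (algebraMap K A t))
          = t ^ k • monomial j a := by
        rw [Polynomial.map_monomial, coe_evalRingHom, eval_monomial, smul_monomial,
          Algebra.smul_def, map_pow, mul_comm]
      rw [this, map_smul, smul_eq_mul, eval_mul, eval_C, eval_pow, eval_X, mul_comm]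

/-- A Lefschetz element modulo `X ^ r` stays one for a generic member of the family
`g.scaleRoots t` degenerating to `X ^ r`. -/
theorem finite_setOf_exists_scaleRoots_dvd [Nontrivial A] (U : Submodule K A[X])
    [FiniteDimensional K U] (g N : A[X]) (hg : g.Monic)
    (hU : ∀ u ∈ U, X ^ g.natDegree ∣ N * u → u = 0) :
    {t : K | ∃ u ∈ U, g.scaleRoots (algebraMap K A t) ∣ N * u ∧ u ≠ 0}.Finite := by
  have hmonic : ∀ t, (g.scaleRoots (algebraMap K A t)).Monic := fun t =>
    (monic_scaleRoots_iff _).2 hg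
  let ψ : K → U →ₗ[K] A[X] := fun t =>
    ((modByMonicHom (g.scaleRoots (algebraMap K A t))).restrictScalars K) ∘ₗ
      (LinearMap.mulLeft K N) ∘ₗ U.subtype
  have hψ : ∀ t (u : U), ψ t u = (N * (u : A[X])) %ₘ g.scaleRoots (algebraMap K A t) :=
    fun t u => rfl
  refine (finite_setOf_not_injective ψ ?_ ?_).subset ?_
  · intro u φ
    let G : A[X][X] := (g.map C).scaleRoots X
    have hG : G.Monic := (monic_scaleRoots_iff _).2 (hg.map C)
    obtain ⟨p, hp⟩ := exists_eval_eq_of_map_eval (((N * (u : A[X])).map C) %ₘ G) φ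
    refine ⟨p, fun t => ?_⟩
    have hC : (evalRingHom (algebraMap K A t)).comp C = RingHom.id A := by ext; simp
    rw [← hp, map_modByMonic _ hG, Polynomial.map_map, hC, Polynomial.map_id, hψ, map_scaleRoots,
      Polynomial.map_map, hC, Polynomial.map_id]
    · simp
    · simp [(hg.map C).leadingCoeff]
  · rw [injective_iff_map_eq_zero]
    intro u hu
    rw [hψ, modByMonic_eq_zero_iff_dvd (hmonic 0), map_zero, scaleRoots_zero,
      hg.leadingCoeff, one_smul] at hu
    exact Subtype.ext (hU u u.2 hu)
  · rintro t ⟨u, hu, hd, hne⟩ hinj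
    refine hne ?_
    have := (injective_iff_map_eq_zero _).1 hinj ⟨u, hu⟩
      (by rw [hψ, modByMonic_eq_zero_iff_dvd (hmonic t)]; exact hd)
    simpa using this

end Deformation

section SimpleExtension

open Polynomial

variable {K A : Type} [Field K] [CommRing A] [Algebra K A]

/-- The grading on `A[X] / g` induced by a grading on `A`, with the root in degree one. -/
noncomputable def adjoinRootFamily (𝒜 : ℤ → Submodule K A) (g : A[X]) (k : ℤ) :
    Submodule K (AdjoinRoot g) :=
  (homogeneousPolys 𝒜 k).map ((AdjoinRoot.mkₐ g).restrictScalars K).toLinearMap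

variable {𝒜 : ℤ → Submodule K A} {g : A[X]}

theorem mem_adjoinRootFamily {k : ℤ} {x : AdjoinRoot g} :
    x ∈ adjoinRootFamily 𝒜 g k ↔ ∃ p ∈ homogeneousPolys 𝒜 k, AdjoinRoot.mk g p = x := Iff.rfl

theorem IsMulFamily.isMulFamily_adjoinRootFamily (h : IsMulFamily 𝒜) :
    IsMulFamily (adjoinRootFamily 𝒜 g) where
  one_mem := ⟨1, h.isMulFamily_homogeneousPolys.one_mem, map_one (AdjoinRoot.mk g)⟩
  mul_mem := by
    rintro i j _ _ ⟨p, hp, rfl⟩ ⟨q, hq, rfl⟩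
    exact ⟨p * q, h.isMulFamily_homogeneousPolys.mul_mem hp hq, map_mul (AdjoinRoot.mk g) p q⟩

theorem of_mem_adjoinRootFamily {k : ℤ} {a : A} (ha : a ∈ 𝒜 k) :
    AdjoinRoot.of g a ∈ adjoinRootFamily 𝒜 g k :=
  ⟨C a, C_mem_homogeneousPolys ha, rfl⟩

theorem IsMulFamily.root_mem (h : IsMulFamily 𝒜) :
    AdjoinRoot.root g ∈ adjoinRootFamily 𝒜 g 1 :=
  ⟨X, h.X_mem, rfl⟩

variable [Nontrivial A]

theorem IsMulFamily.modByMonicHom_mem (h : IsMulFamily 𝒜) (hg : g.Monic)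
    (hgh : g ∈ homogeneousPolys 𝒜 g.natDegree) {k : ℤ} {x : AdjoinRoot g}
    (hx : x ∈ adjoinRootFamily 𝒜 g k) :
    AdjoinRoot.modByMonicHom hg x ∈ homogeneousPolys 𝒜 k := by
  obtain ⟨p, hp, rfl⟩ := mem_adjoinRootFamily.1 hx
  rw [AdjoinRoot.modByMonicHom_mk]
  exact (h.divByMonic_modByMonic_mem hg hgh hp).2

theorem degree_modByMonicHom_lt (hg : g.Monic) (x : AdjoinRoot g) :
    (AdjoinRoot.modByMonicHom hg x).degree < g.degree := by
  obtain ⟨p, rfl⟩ := AdjoinRoot.mk_surjective x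
  rw [AdjoinRoot.modByMonicHom_mk]
  exact degree_modByMonic_lt p hg

theorem IsMulFamily.finrank_adjoinRootFamily [FiniteDimensional K A] (h : IsMulFamily 𝒜)
    (hg : g.Monic) (hgh : g ∈ homogeneousPolys 𝒜 g.natDegree) (k : ℤ) :
    Module.finrank K (adjoinRootFamily 𝒜 g k) =
      ∑ j : Fin g.natDegree, Module.finrank K (𝒜 (k - (j : ℕ))) := by
  let Θ : adjoinRootFamily 𝒜 g k →ₗ[K] ∀ j : Fin g.natDegree, 𝒜 (k - (j : ℕ)) :=
    LinearMap.pi fun j =>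
      LinearMap.codRestrict _
        (((lcoeff A j).restrictScalars K) ∘ₗ
          ((AdjoinRoot.modByMonicHom hg).restrictScalars K) ∘ₗ Submodule.subtype _)
        fun x => h.modByMonicHom_mem hg hgh x.2 j
  have hΘ : ∀ x (j : Fin g.natDegree), ((Θ x j : 𝒜 (k - (j : ℕ))) : A) =
      (AdjoinRoot.modByMonicHom hg (x : AdjoinRoot g)).coeff j := fun _ _ => rfl
  have hbij : Function.Bijective Θ := by
    constructor
    · rw [injective_iff_map_eq_zero]
      intro x hx
      have h0 : AdjoinRoot.modByMonicHom hg (x : AdjoinRoot g) = 0 := by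
        ext j
        by_cases hj : j < g.natDegree
        · have := hΘ x ⟨j, hj⟩
          rw [hx] at this
          simpa using this.symm
        · refine coeff_eq_zero_of_degree_lt ((degree_modByMonicHom_lt hg _).trans_le ?_)
          rw [degree_eq_natDegree hg.ne_zero]
          exact_mod_cast not_lt.1 hj
      have := AdjoinRoot.mk_leftInverse hg (x : AdjoinRoot g)
      rw [h0, map_zero] at this
      exact Subtype.ext this.symm
    · intro a
      let p : A[X] := ∑ j : Fin g.natDegree, monomial (j : ℕ) (a j : A)
      have hp : p ∈ homogeneousPolys 𝒜 k :=
        sum_mem fun j _ => monomial_mem_homogeneousPolys (a j).2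
      have hdeg : p.degree < g.degree := by
        rw [degree_eq_natDegree hg.ne_zero]
        refine (degree_sum_le _ _).trans_lt ((Finset.sup_lt_iff (WithBot.bot_lt_coe _)).2 ?_)
        intro j _
        exact (degree_monomial_le _ _).trans_lt (by exact_mod_cast j.2)
      refine ⟨⟨AdjoinRoot.mk g p, p, hp, rfl⟩, ?_⟩
      ext j
      rw [hΘ, AdjoinRoot.modByMonicHom_mk, (modByMonic_eq_self_iff hg).2 hdeg, finsetSum_coeff,
        Finset.sum_eq_single j]
      · simp
      · intro i _ hij
        rw [coeff_monomial, if_neg (fun h => hij (Fin.ext h))]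
      · simp
  rw [(LinearEquiv.ofBijective Θ hbij).finrank_eq, Module.finrank_pi_fintype]

theorem IsLefschetzFamily.exists_lefschetz_adjoinRoot [CharZero K] [FiniteDimensional K A] {c : ℤ}
    (h : IsLefschetzFamily 𝒜 c) (hg : g.Monic)
    (hgh : g ∈ homogeneousPolys 𝒜 g.natDegree) {s : ℕ} (hs : g.natDegree = s + 1) :
    ∃ l ∈ adjoinRootFamily 𝒜 g 1, ∀ (i m : ℕ), (m : ℤ) = c + s - 2 * i →
      ∀ v ∈ adjoinRootFamily 𝒜 g i, l ^ m * v = 0 → v = 0 := by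
  obtain ⟨l, hl, hlef⟩ := h.exists_lefschetz
  have := hg.finite_adjoinRoot
  have : FiniteDimensional K (AdjoinRoot g) := Module.Finite.trans A _
  have hgdeg : g.degree = ((s + 1 : ℕ) : WithBot ℕ) := by
    rw [degree_eq_natDegree hg.ne_zero, hs]
  let U : ℕ → Submodule K A[X] := fun i =>
    homogeneousPolys 𝒜 i ⊓ (degreeLT A (s + 1)).restrictScalars K
  have hUcoeff : ∀ i, ∀ u ∈ U i, ∀ j, s + 1 ≤ j → u.coeff j = 0 := fun i u hu =>
    (degree_lt_iff_coeff_zero _ _).1 (mem_degreeLT.1 hu.2)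
  have hUfin : ∀ i, FiniteDimensional K (U i) := fun i => by
    refine FiniteDimensional.of_injective
      (((AdjoinRoot.mkₐ g).restrictScalars K).toLinearMap ∘ₗ (U i).subtype) ?_
    rw [injective_iff_map_eq_zero]
    intro u hu
    have hd : g ∣ (u : A[X]) := AdjoinRoot.mk_eq_zero.1 hu
    by_contra hne
    exact hg.not_dvd_of_degree_lt (fun h0 => hne (Subtype.ext h0))
      (hgdeg ▸ mem_degreeLT.1 u.2.2) hd
  let bad : ℕ → Set K := fun i => {t : K | ∃ u ∈ U i,
    g.scaleRoots (algebraMap K A t) ∣ (C l + X) ^ (c + s - 2 * i).toNat * u ∧ u ≠ 0}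
  have hbad : ∀ i : ℕ, 2 * (i : ℤ) ≤ c + s → (bad i).Finite := by
    intro i hi
    refine finite_setOf_exists_scaleRoots_dvd (U i) g _ hg fun u hu hd => ?_
    rw [hs] at hd
    have := X_pow_dvd_of_lefschetz hlef s i _ (Int.toNat_of_nonneg (by linarith)) u hu.1 hd
    rw [X_pow_dvd_iff] at this
    ext j
    by_cases hj : j < s + 1
    · exact this j hj
    · exact hUcoeff i u hu j (not_lt.1 hj)
  have hfin : ({0} ∪ ⋃ i ∈ {i : ℕ | 2 * (i : ℤ) ≤ c + s}, bad i).Finite := by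
    refine (Set.finite_singleton 0).union (Set.Finite.biUnion ?_ hbad)
    refine (Set.finite_Iic (c + s).toNat).subset fun i hi => ?_
    simp only [Set.mem_ofPred_eq, Set.mem_Iic] at hi ⊢
    omega
  obtain ⟨t, ht⟩ := hfin.exists_notMem
  simp only [Set.mem_union, Set.mem_singleton_iff, Set.mem_iUnion, not_or, not_exists] at ht
  obtain ⟨ht0, ht⟩ := ht
  set a := algebraMap K A t
  set b := algebraMap K A t⁻¹
  have hab : a * b = 1 := by rw [← map_mul, mul_inv_cancel₀ ht0, map_one]
  have hscale : g.scaleRoots a = C (a ^ (s + 1)) * g.comp (C b * X) := by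
    ext j
    rw [coeff_scaleRoots, coeff_C_mul, comp_C_mul_X_coeff, hs]
    by_cases hj : j ≤ s + 1
    · obtain ⟨k, hk⟩ := Nat.exists_eq_add_of_le hj
      have hab' : a ^ j * b ^ j = 1 := by rw [← mul_pow, hab, one_pow]
      rw [hk, Nat.add_sub_cancel_left, pow_add]
      linear_combination -(g.coeff j * a ^ k) * hab'
    · rw [coeff_eq_zero_of_natDegree_lt (by omega)]
      simp
  refine ⟨AdjoinRoot.mk g (C l + C a * X), ⟨_, ?_, rfl⟩, ?_⟩
  · refine add_mem (C_mem_homogeneousPolys hl) ?_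
    rw [C_mul_X_eq_monomial]
    refine monomial_mem_homogeneousPolys ?_
    rw [show a = t • (1 : A) from Algebra.algebraMap_eq_smul_one t]
    simpa using (𝒜 0).smul_mem t h.one_mem
  intro i m hm v hv hmv
  set p := AdjoinRoot.modByMonicHom hg v
  have hpv : AdjoinRoot.mk g p = v := AdjoinRoot.mk_leftInverse hg v
  have hph := h.modByMonicHom_mem hg hgh hv
  have hpd : p.degree < ((s + 1 : ℕ) : WithBot ℕ) := hgdeg ▸ degree_modByMonicHom_lt hg v
  rw [← hpv, ← map_pow, ← map_mul, AdjoinRoot.mk_eq_zero] at hmv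
  have hpU : p.comp (C b * X) ∈ U i := by
    refine ⟨fun j => ?_, mem_degreeLT.2 ((degree_lt_iff_coeff_zero _ _).2 fun j hj => ?_)⟩
    · rw [comp_C_mul_X_coeff, mul_comm, ← map_pow, ← Algebra.smul_def]
      exact Submodule.smul_mem _ _ (hph j)
    · rw [comp_C_mul_X_coeff, (degree_lt_iff_coeff_zero _ _).1 hpd j hj, zero_mul]
  have hdvd : g.scaleRoots a ∣ (C l + X) ^ m * p.comp (C b * X) := by
    have hu : IsUnit (C (a ^ (s + 1))) := ((IsUnit.of_mul_eq_one _ hab).pow _).map C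
    rw [hscale, hu.mul_left_dvd]
    have := map_dvd (compRingHom (C b * X)) hmv
    simp only [coe_compRingHom_apply, mul_comp, pow_comp, add_comp, C_comp, X_comp] at this
    rwa [← mul_assoc, ← C_mul, hab, C_1, one_mul] at this
  have hm' : (c + s - 2 * i).toNat = m := by omega
  have hzero : p.comp (C b * X) = 0 := by
    by_contra hne
    exact ht i (show 2 * (i : ℤ) ≤ c + s by omega) ⟨_, hpU, hm' ▸ hdvd, hne⟩
  have hp0 : p = 0 := by
    ext j
    have := congrArg (fun q => coeff q j) hzero
    simp only [comp_C_mul_X_coeff, coeff_zero] at this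
    have hu : IsUnit (b ^ j) := (IsUnit.of_mul_eq_one a (by rw [mul_comm, hab])).pow _
    exact (hu.mul_left_eq_zero).1 this
  rw [← hpv, hp0, map_zero]

/-- A simple extension of a Lefschetz family by a homogeneous monic polynomial is Lefschetz. -/
theorem IsLefschetzFamily.isLefschetzFamily_adjoinRootFamily [CharZero K] [FiniteDimensional K A]
    {c : ℤ} (h : IsLefschetzFamily 𝒜 c) (hg : g.Monic)
    (hgh : g ∈ homogeneousPolys 𝒜 g.natDegree) {s : ℕ} (hs : g.natDegree = s + 1) :
    IsLefschetzFamily (adjoinRootFamily 𝒜 g) (c + s) where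
  toIsMulFamily := h.isMulFamily_adjoinRootFamily
  eq_bot i hi := by
    rw [Submodule.eq_bot_iff]
    intro x hx
    have hp : AdjoinRoot.modByMonicHom hg x = 0 := by
      ext j
      by_cases hj : j < s + 1
      · have := h.modByMonicHom_mem hg hgh hx j
        rwa [h.eq_bot _ (by omega)] at this
      · refine coeff_eq_zero_of_degree_lt ((degree_modByMonicHom_lt hg _).trans_le ?_)
        rw [degree_eq_natDegree hg.ne_zero, hs]
        exact_mod_cast not_lt.1 hj
    rw [← AdjoinRoot.mk_leftInverse hg x, hp, map_zero]
  finrank_symm k := by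
    rw [h.finrank_adjoinRootFamily hg hgh, h.finrank_adjoinRootFamily hg hgh,
      ← Equiv.sum_comp Fin.revPerm]
    refine Finset.sum_congr rfl fun j _ => ?_
    rw [h.finrank_symm, Fin.revPerm_apply, Fin.val_rev,
      show c - (k - ((g.natDegree - (j + 1) : ℕ) : ℤ)) = c + s - k - (j : ℕ) by omega]
  exists_lefschetz := by
    obtain ⟨l, hl, H⟩ := h.exists_lefschetz_adjoinRoot hg hgh hs
    refine ⟨l, hl, fun i m hm v hv hmv => ?_⟩
    rcases le_or_gt 0 i with hi | hi
    · lift i to ℕ using hi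
      exact H i m hm v hv hmv
    · obtain ⟨p, hp, rfl⟩ := mem_adjoinRootFamily.1 hv
      have : p = 0 := by
        ext j
        have := hp j
        rwa [h.eq_bot _ (by omega)] at this
      rw [this, map_zero]

end SimpleExtension

section SplittingAlgebra

open Polynomial

variable {K : Type} [Field K]

theorem nontrivial_adjoinRoot {A : Type} [CommRing A] [Nontrivial A] {P : A[X]} (hP : P.Monic)
    (hdeg : P.natDegree ≠ 0) : Nontrivial (AdjoinRoot P) := by
  refine ⟨0, 1, fun h01 => ?_⟩
  have h1 : AdjoinRoot.mk P 1 = 0 := by rw [map_one, h01]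
  exact hP.not_dvd_of_natDegree_lt one_ne_zero (by rw [natDegree_one]; omega)
    (AdjoinRoot.mk_eq_zero.1 h1)

/-- The universal splitting algebra of a homogeneous monic polynomial over a Lefschetz family
carries a Lefschetz family with the roots in degree one. -/
theorem IsLefschetzFamily.exists_splitting [CharZero K] (n : ℕ) :
    ∀ {A : Type} [CommRing A] [Algebra K A] [Nontrivial A] [FiniteDimensional K A]
      {𝒜 : ℤ → Submodule K A} {c : ℤ} {P : A[X]}, IsLefschetzFamily 𝒜 c → P.Monic →
      P.natDegree = n → P ∈ homogeneousPolys 𝒜 n →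
      ∃ (B : Type) (_ : CommRing B) (_ : Algebra K B) (ℬ : ℤ → Submodule K B) (c' : ℤ)
        (ι : A →ₐ[K] B) (x : Fin n → B),
        Nontrivial B ∧ FiniteDimensional K B ∧ IsLefschetzFamily ℬ c' ∧
        P.map (ι : A →+* B) = ∏ i, (X - C (x i)) ∧
        (∀ (T : Type) [CommRing T] [Algebra K T] (φ : A →ₐ[K] T) (y : Fin n → T),
          P.map (φ : A →+* T) = ∏ i, (X - C (y i)) →
          ∃ Φ : B →ₐ[K] T, Φ.comp ι = φ ∧ ∀ i, Φ (x i) = y i) ∧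
        (∀ i, x i ∈ ℬ 1) ∧ (∀ k, ∀ a ∈ 𝒜 k, ι a ∈ ℬ k) ∧
        (∀ 𝒟 : ℤ → Submodule K B, IsMulFamily 𝒟 → (∀ k, ∀ a ∈ 𝒜 k, ι a ∈ 𝒟 k) →
          (∀ i, x i ∈ 𝒟 1) → ∀ k, ℬ k ≤ 𝒟 k) := by
  induction n with
  | zero =>
    intro A _ _ _ _ 𝒜 c P h hP hdeg _
    obtain rfl := hP.natDegree_eq_zero.1 hdeg
    exact ⟨A, inferInstance, inferInstance, 𝒜, c, AlgHom.id K A, Fin.elim0, inferInstance,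
      inferInstance, h, by simp, fun T _ _ φ y _ => ⟨φ, AlgHom.comp_id φ, fun i => i.elim0⟩,
      fun i => i.elim0, fun k a ha => ha, fun 𝒟 _ hD _ k a ha => hD k a ha⟩
  | succ n ih =>
    intro A _ _ _ _ 𝒜 c P h hP hdeg hPh
    have hPh' : P ∈ homogeneousPolys 𝒜 P.natDegree := by rwa [hdeg]
    have hB := h.isLefschetzFamily_adjoinRootFamily hP hPh' hdeg
    have := hP.finite_adjoinRoot
    have : FiniteDimensional K (AdjoinRoot P) := Module.Finite.trans A _
    have := nontrivial_adjoinRoot hP (by omega)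
    set z := AdjoinRoot.root P
    set PB := P.map (AdjoinRoot.of P)
    have hPB : PB.Monic := hP.map _
    have hPBdeg : PB.natDegree = n + 1 := by rw [hP.natDegree_map, hdeg]
    set Q := PB /ₘ (X - C z)
    have hmul : (X - C z) * Q = PB := mul_divByMonic_eq_iff_isRoot.2 (AdjoinRoot.isRoot_root P)
    have hQ : Q.Monic := (monic_X_sub_C z).of_mul_monic_left (hmul ▸ hPB)
    have hQdeg : Q.natDegree = n := by
      rw [natDegree_divByMonic _ (monic_X_sub_C z), hPBdeg, natDegree_X_sub_C]; rfl
    have hPBh : PB ∈ homogeneousPolys (adjoinRootFamily 𝒜 P) (n + 1 : ℕ) := fun j => by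
      rw [coeff_map]
      exact of_mem_adjoinRootFamily (hPh j)
    have hXz : X - C z ∈ homogeneousPolys (adjoinRootFamily 𝒜 P) 1 :=
      sub_mem hB.X_mem (C_mem_homogeneousPolys h.root_mem)
    have hQh : Q ∈ homogeneousPolys (adjoinRootFamily 𝒜 P) n := by
      have := (hB.divByMonic_modByMonic_mem (monic_X_sub_C z) (by simpa using hXz) hPBh).1
      simpa using this
    obtain ⟨B, iB, aB, ℬ, c', ι, x, hnt, hfd, hL, hsplit, huniv, hx, hι, hgen⟩ :=
      ih hB hQ hQdeg hQh
    refine ⟨B, iB, aB, ℬ, c', ι.comp (AdjoinRoot.ofAlgHom K P), Fin.cons (ι z) x, hnt, hfd, hL,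
      ?_, ?_, ?_, ?_, ?_⟩
    · have := congrArg (Polynomial.map (ι : AdjoinRoot P →+* B)) hmul
      rw [Polynomial.map_mul, hsplit, Polynomial.map_map] at this
      rw [Fin.prod_univ_succ]
      simp only [Polynomial.map_sub, Polynomial.map_X, Polynomial.map_C, RingHom.coe_coe] at this
      exact this.symm
    · intro T _ _ φ y hy
      rw [Fin.prod_univ_succ] at hy
      have hroot : P.eval₂ (φ : A →+* T) (y 0) = 0 := by
        rw [← eval_map, hy]; simp
      let φ' := AdjoinRoot.liftAlgHom P φ (y 0) hroot
      have hφ' : (φ' : AdjoinRoot P →+* T).comp (AdjoinRoot.of P) = φ := by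
        ext a; exact AdjoinRoot.liftAlgHom_of P φ (y 0) hroot a
      have hφz : φ' z = y 0 := AdjoinRoot.liftAlgHom_root ..
      obtain ⟨Φ, hΦ, hΦx⟩ := huniv T φ' (fun i => y i.succ) (by
        have := congrArg (Polynomial.map (φ' : AdjoinRoot P →+* T)) hmul
        rw [Polynomial.map_mul, Polynomial.map_map, hφ', hy] at this
        simp only [Polynomial.map_sub, Polynomial.map_X, Polynomial.map_C, RingHom.coe_coe,
          hφz] at this
        exact (monic_X_sub_C (y 0)).isRegular.left this)
      refine ⟨Φ, ?_, ?_⟩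
      · rw [← AlgHom.comp_assoc, hΦ]
        ext a; exact AdjoinRoot.liftAlgHom_of P φ (y 0) hroot a
      · intro i
        refine Fin.cases ?_ (fun i => ?_) i
        · rw [Fin.cons_zero, ← hφz, ← hΦ]; rfl
        · rw [Fin.cons_succ]; exact hΦx i
    · intro i
      refine Fin.cases ?_ (fun i => ?_) i
      · exact hι 1 z h.root_mem
      · exact hx i
    · exact fun k a ha => hι k _ (of_mem_adjoinRootFamily ha)
    · intro 𝒟 hD hDι hDx
      refine hgen 𝒟 hD ?_ fun i => by simpa using hDx i.succ
      rintro k _ ⟨p, hp, rfl⟩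
      have hz : ι z ∈ 𝒟 1 := by simpa using hDx 0
      change ι (AdjoinRoot.mk P p) ∈ 𝒟 k
      rw [p.as_sum_range_C_mul_X_pow, map_sum, map_sum]
      refine sum_mem fun j _ => ?_
      have := hD.mul_mem (hDι _ _ (hp j)) (hD.pow_mem hz j)
      rw [sub_add_cancel] at this
      simpa using this

theorem isLefschetzFamily_self :
    IsLefschetzFamily (K := K) (A := K) (fun k => if k = 0 then ⊤ else ⊥) 0 where
  one_mem := by simp
  mul_mem {i j x y} hx hy := by
    by_cases hi : i = 0
    · by_cases hj : j = 0
      · simp [hi, hj]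
      · simp only [hj, if_false, Submodule.mem_bot] at hy
        simp [hy]
    · simp only [hi, if_false, Submodule.mem_bot] at hx
      simp [hx]
  eq_bot i hi := by rw [if_neg (by omega)]
  finrank_symm i :=
    congrArg (fun s : Submodule K K => Module.finrank K s) (by simp only [zero_sub, neg_eq_zero])
  exists_lefschetz := by
    refine ⟨0, zero_mem _, fun i m hm v hv h => ?_⟩
    by_cases hi : i = 0
    · obtain rfl : m = 0 := by omega
      simpa using h
    · simpa [hi] using hv

/-- A graded algebra that embeds onto a Lefschetz family has the strong Lefschetz property. -/
theorem IsLefschetzFamily.algHasSLP {B Q : Type} [CommRing B] [Algebra K B] [Nontrivial B]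
    [FiniteDimensional K B] [CommRing Q] [Algebra K Q] {ℬ : ℤ → Submodule K B} {c : ℤ}
    (h : IsLefschetzFamily ℬ c) {𝒬 : ℕ → Submodule K Q} (ψ : Q →ₐ[K] B)
    (hψ : Function.Injective ψ) (hmap : ∀ k : ℕ, (𝒬 k).map ψ.toLinearMap = ℬ k) :
    AlgHasSLP K 𝒬 := by
  have hmem : ∀ k : ℕ, ∀ q, q ∈ 𝒬 k ↔ ψ q ∈ ℬ k := by
    intro k q
    rw [← hmap]
    exact ⟨fun hq => ⟨q, hq, rfl⟩, fun ⟨q', hq', e⟩ => hψ e ▸ hq'⟩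
  have hc : 0 ≤ c := by
    by_contra hc
    have := h.one_mem
    rw [h.eq_bot 0 (by omega)] at this
    exact one_ne_zero ((Submodule.mem_bot K).1 this)
  lift c to ℕ using hc
  obtain ⟨l, hl, hlef⟩ := h.exists_lefschetz
  obtain ⟨g, hg, rfl⟩ : ∃ g ∈ 𝒬 1, ψ g = l := by
    have : l ∈ (𝒬 1).map ψ.toLinearMap := by rw [hmap]; exact hl
    exact this
  refine ⟨c, ⟨fun hbot => ?_, fun i hi => ?_⟩, g, hg, fun i hi => ⟨fun v hv hgv => ?_, ?_⟩⟩
  · have h1 : g ^ c ∈ 𝒬 c := by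
      rw [hmem, map_pow]; exact h.pow_mem hl c
    rw [hbot, Submodule.mem_bot] at h1
    refine one_ne_zero (hlef 0 c (by simp) 1 h.one_mem ?_)
    rw [mul_one, ← map_pow, h1, map_zero]
  · rw [Submodule.eq_bot_iff]
    intro q hq
    rw [hmem, h.eq_bot i (by omega), Submodule.mem_bot] at hq
    exact hψ (by rw [hq, map_zero])
  · refine hψ ((hlef i (c - 2 * i) (by omega) _ ((hmem _ _).1 hv) ?_).trans (map_zero _).symm)
    rw [← map_pow, ← map_mul, hgv, map_zero]
  · intro w hw
    let L : ℬ i →ₗ[K] ℬ ((c : ℤ) - i) :=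
      ((LinearMap.mulLeft K (ψ g ^ (c - 2 * i))).comp (ℬ i).subtype).codRestrict _ fun v => by
        have := h.mul_mem (h.pow_mem hl (c - 2 * i)) v.2
        rwa [show ((c - 2 * i : ℕ) : ℤ) + i = c - i by omega] at this
    have hL : Function.Injective L := by
      rw [injective_iff_map_eq_zero]
      intro v hv
      exact Subtype.ext (hlef i (c - 2 * i) (by omega) _ v.2 (congrArg Subtype.val hv))
    have hw' : ψ w ∈ ℬ ((c : ℤ) - i) := by
      rw [hmem] at hw
      rwa [show ((c - i : ℕ) : ℤ) = (c : ℤ) - i by omega] at hw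
    obtain ⟨v, hv⟩ := (LinearMap.injective_iff_surjective_of_finrank_eq_finrank
      (h.finrank_symm i)).1 hL ⟨ψ w, hw'⟩
    obtain ⟨v', hv', e⟩ : ∃ v' ∈ 𝒬 i, ψ v' = v := by
      have : (v : B) ∈ (𝒬 i).map ψ.toLinearMap := by rw [hmap]; exact v.2
      exact this
    refine ⟨v', hv', hψ ?_⟩
    rw [map_mul, map_pow, e]
    exact congrArg Subtype.val hv

end SplittingAlgebra

section SymmetricPolynomials

open MvPolynomial

variable {K : Type} [Field K] {n : ℕ}

theorem exists_sub_aeval_esymmS_one_mem (s : symS K n) :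
    ∃ F : Polynomial K, s - Polynomial.aeval (esymmS K n 1) F ∈
      Ideal.ofList ((List.range (n - 1)).map fun j => esymmS K n (j + 2)) := by
  set J := Ideal.ofList ((List.range (n - 1)).map fun j => esymmS K n (j + 2))
  obtain ⟨E, hX, hE⟩ : ∃ E : MvPolynomial (Fin n) K →ₐ[K] symS K n,
      (∀ i, E (X i) = esymmS K n (i + 1)) ∧ Function.Surjective E :=
    ⟨esymmAlgHom (Fin n) K n, fun i => aeval_X (S₁ := symmetricSubalgebra (Fin n) K) _ i,
      esymmAlgHom_surjective (σ := Fin n) K (n := n) (by simp)⟩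
  obtain ⟨q, rfl⟩ := hE s
  induction q using MvPolynomial.induction_on with
  | C a =>
    refine ⟨Polynomial.C a, ?_⟩
    rw [Polynomial.aeval_C, ← algebraMap_eq, AlgHom.commutes]
    exact (sub_self (algebraMap K (symS K n) a)) ▸ zero_mem J
  | add p q hp hq =>
    obtain ⟨F, hF⟩ := hp
    obtain ⟨G, hG⟩ := hq
    refine ⟨F + G, ?_⟩
    rw [map_add, map_add, add_sub_add_comm]
    exact add_mem hF hG
  | mul_X p i hp =>
    rw [map_mul, hX]
    by_cases hi : (i : ℕ) = 0
    · obtain ⟨F, hF⟩ := hp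
      refine ⟨F * Polynomial.X, ?_⟩
      rw [map_mul, Polynomial.aeval_X, hi, zero_add, ← sub_mul]
      exact J.mul_mem_right _ hF
    · refine ⟨0, ?_⟩
      rw [map_zero, sub_zero]
      refine J.mul_mem_left _ (Ideal.subset_span (List.mem_map.2 ⟨i - 1, ?_, ?_⟩))
      · rw [List.mem_range]; omega
      · congr 1; omega

theorem eval_single_esymm_one (i : Fin n) (t : K) :
    eval (Pi.single i t) (esymm (Fin n) K 1) = t := by
  simp [esymm_one]

theorem eval_single_esymm_add_two (i : Fin n) (t : K) (j : ℕ) :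
    eval (Pi.single i t) (esymm (Fin n) K (j + 2)) = 0 := by
  rw [esymm, map_sum]
  refine Finset.sum_eq_zero fun s hs => ?_
  rw [map_prod]
  obtain ⟨k, hk, hki⟩ := Finset.exists_mem_ne
    (by rw [(Finset.mem_powersetCard.1 hs).2]; omega) i
  exact Finset.prod_eq_zero hk (by simp [hki])

theorem MvPolynomial.IsHomogeneous.eval_mul {σ R : Type} [Fintype σ] [CommRing R]
    {f : MvPolynomial σ R} {d : ℕ} (hf : f.IsHomogeneous d) (t : R) (v : σ → R) :
    eval (fun i => t * v i) f = t ^ d * eval v f := by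
  rw [eval_eq', eval_eq', Finset.mul_sum]
  refine Finset.sum_congr rfl fun m hm => ?_
  have hd : ∑ i, m i = d := by
    rw [← hf (mem_support_iff.1 hm), Finsupp.weight_apply, Finsupp.sum_fintype _ _ (by simp)]
    simp
  simp_rw [mul_pow, Finset.prod_mul_distrib, Finset.prod_pow_eq_pow_sum, hd]
  ring

/-- A homogeneous symmetric polynomial completing `e₂, …, eₙ` to a regular sequence is, modulo
`e₂, …, eₙ`, a nonzero multiple of a positive power of `e₁`. -/
theorem exists_sub_C_mul_esymm_one_pow_mem [CharZero K] (hn : 0 < n)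
    (f : MvPolynomial (Fin n) K) (hfsym : f.IsSymmetric) (d : ℕ) (hf : f.IsHomogeneous d)
    (hreg : RingTheory.Sequence.IsRegular (symS K n)
      (((List.range (n - 1)).map fun j => esymmS K n (j + 2)) ++
        [⟨f, (mem_symS K n _).mpr hfsym⟩])) :
    d ≠ 0 ∧ ∃ a : K, a ≠ 0 ∧ f - C a * esymm (Fin n) K 1 ^ d ∈
      Ideal.span (Set.range fun j : Fin (n - 1) => esymm (Fin n) K ((j : ℕ) + 2)) := by
  set rs := (List.range (n - 1)).map fun j => esymmS K n (j + 2)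
  set fS : symS K n := ⟨f, (mem_symS K n _).mpr hfsym⟩
  let i₀ : Fin n := ⟨0, hn⟩
  obtain ⟨F, hF⟩ := exists_sub_aeval_esymmS_one_mem fS
  have hJ : ∀ s ∈ Ideal.ofList rs, ∀ t : K,
      eval (Pi.single i₀ t) (s : MvPolynomial (Fin n) K) = 0 := by
    intro s hs t
    have hle : Ideal.ofList rs ≤
        RingHom.ker ((eval (Pi.single i₀ t)).comp (symS K n).val.toRingHom) := by
      refine Ideal.span_le.2 fun x hx => ?_
      obtain ⟨j, _, rfl⟩ := List.mem_map.1 hx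
      exact eval_single_esymm_add_two i₀ t j
    exact hle hs
  set a := eval (Pi.single i₀ 1) f
  have hev : ∀ (v : Fin n → K) (q : MvPolynomial (Fin n) K), aeval v q = eval v q :=
    fun v q => by rw [← coe_aeval_eq_eval]; rfl
  have hFa : F = Polynomial.C a * Polynomial.X ^ d := by
    refine Polynomial.funext fun t => ?_
    have h1 := hJ _ hF t
    have h2 : ((Polynomial.aeval (esymmS K n 1) F : symS K n) : MvPolynomial (Fin n) K) =
        Polynomial.aeval (esymm (Fin n) K 1) F :=
      (Polynomial.aeval_algHom_apply (symS K n).val (esymmS K n 1) F).symm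
    have h3 : eval (Pi.single i₀ t) (Polynomial.aeval (esymm (Fin n) K 1) F) = F.eval t := by
      have := Polynomial.aeval_algHom_apply (aeval (Pi.single i₀ t : Fin n → K))
        (esymm (Fin n) K 1) F
      rw [hev, eval_single_esymm_one] at this
      rw [← hev, ← this, Polynomial.coe_aeval_eq_eval]
    have h4 := hf.eval_mul t (Pi.single i₀ 1)
    have h5 : (fun i => t * (Pi.single i₀ 1 : Fin n → K) i) = Pi.single i₀ t := by
      ext i; simp [Pi.single_apply]
    rw [h5] at h4
    rw [AddSubgroupClass.coe_sub, h2, map_sub, h3, h4, sub_eq_zero] at h1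
    rw [← h1, Polynomial.eval_mul, Polynomial.eval_C, Polynomial.eval_pow, Polynomial.eval_X,
      mul_comm]
  rw [hFa] at hF
  have htop : Ideal.ofList (rs ++ [fS]) ≠ ⊤ := fun h => hreg.top_ne_smul (by simp [h])
  have ha : a ≠ 0 := by
    intro ha
    rw [ha] at hF
    have hfJ : fS ∈ Ideal.ofList rs := by simpa using hF
    have hr := (RingTheory.Sequence.isWeaklyRegular_singleton_iff _ _).1
      ((RingTheory.Sequence.isWeaklyRegular_append_iff _ _ _).1 hreg.toIsWeaklyRegular).2
    have h1 : (Submodule.Quotient.mk 1 :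
        symS K n ⧸ (Ideal.ofList rs • ⊤ : Submodule (symS K n) (symS K n))) = 0 := by
      refine hr ?_
      change fS • Submodule.Quotient.mk 1 = fS • 0
      rw [smul_zero, ← Submodule.Quotient.mk_smul, Submodule.Quotient.mk_eq_zero]
      simpa using hfJ
    rw [Submodule.Quotient.mk_eq_zero] at h1
    refine htop ((Ideal.eq_top_iff_one _).2 ?_)
    rw [Ideal.ofList_append]
    exact Ideal.mem_sup_left (by simpa using h1)
  refine ⟨?_, a, ha, ?_⟩
  · rintro rfl
    apply htop
    have hfJ : fS - algebraMap K _ a ∈ Ideal.ofList (rs ++ [fS]) := by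
      rw [Ideal.ofList_append]
      exact Ideal.mem_sup_left (by simpa using hF)
    have hf : fS ∈ Ideal.ofList (rs ++ [fS]) := Ideal.subset_span (by simp)
    have := (Submodule.sub_mem_iff_right _ hf).1 hfJ
    exact Ideal.eq_top_of_isUnit_mem _ this ((isUnit_iff_ne_zero.2 ha).map _)
  · have hle : (Ideal.ofList rs).map (symS K n).val.toRingHom ≤
        Ideal.span (Set.range fun j : Fin (n - 1) => esymm (Fin n) K ((j : ℕ) + 2)) := by
      refine Ideal.map_le_iff_le_comap.2 (Ideal.span_le.2 fun x hx => ?_)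
      obtain ⟨j, hj, rfl⟩ := List.mem_map.1 hx
      exact Ideal.subset_span ⟨⟨j, List.mem_range.1 hj⟩, rfl⟩
    rw [map_mul, map_pow, Polynomial.aeval_X, Polynomial.aeval_C] at hF
    exact hle (Ideal.mem_map_of_mem _ hF)

theorem prod_X_sub_C_eq_iff {T : Type} [CommRing T] [Algebra K T] (hn : 0 < n) (y : Fin n → T)
    (e : T) : (Polynomial.X ^ n - Polynomial.C e * Polynomial.X ^ (n - 1) =
      ∏ i, (Polynomial.X - Polynomial.C (y i))) ↔
      MvPolynomial.aeval y (esymm (Fin n) K 1) = e ∧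
        ∀ j : Fin (n - 1), MvPolynomial.aeval y (esymm (Fin n) K (j + 2)) = 0 := by
  obtain ⟨n, rfl⟩ := Nat.exists_eq_succ_of_ne_zero hn.ne'
  change Polynomial.X ^ (n + 1) - Polynomial.C e * Polynomial.X ^ n = _ ↔ _ ∧ ∀ j : Fin n, _
  have hcoeff : ∀ k ≤ n + 1, (∏ i, (Polynomial.X - Polynomial.C (y i))).coeff k =
      (-1) ^ (n + 1 - k) * MvPolynomial.aeval y (esymm (Fin (n + 1)) K (n + 1 - k)) := by
    intro k hk
    have := Multiset.prod_X_sub_C_coeff (Finset.univ.val.map y) (k := k) (by simpa using hk)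
    rw [aeval_esymm_eq_multiset_esymm]
    rw [Multiset.map_map, Multiset.card_map, Finset.card_val, Finset.card_univ,
      Fintype.card_fin] at this
    exact this
  constructor
  · intro h
    constructor
    · have := hcoeff n (by omega)
      rw [← h] at this
      simpa [Polynomial.coeff_X_pow] using this.symm
    · intro j
      have := hcoeff (n - 1 - j) (by omega)
      rw [← h, show n + 1 - (n - 1 - j) = (j : ℕ) + 2 by omega] at this
      have h1 : n - 1 - (j : ℕ) ≠ n + 1 := by omega
      have h2 : n - 1 - (j : ℕ) ≠ n := by omega
      have hu : IsUnit ((-1 : T) ^ ((j : ℕ) + 2)) := (isUnit_one.neg).pow _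
      refine (hu.mul_right_eq_zero).1 ?_
      rw [← this]
      simp [Polynomial.coeff_X_pow, h1, h2]
  · rintro ⟨h1, h2⟩
    ext k
    by_cases hk : k ≤ n + 1
    · rw [hcoeff k hk]
      rcases Nat.lt_or_ge k n with hkn | hkn
      · have := h2 ⟨n - 1 - k, by omega⟩
        rw [show n - 1 - k + 2 = n + 1 - k by omega] at this
        simp [this, Polynomial.coeff_X_pow, show k ≠ n + 1 by omega, show k ≠ n by omega]
      · rcases Nat.eq_or_lt_of_le hkn with rfl | hkn
        · rw [Nat.add_sub_cancel_left, h1]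
          simp [Polynomial.coeff_X_pow]
        · obtain rfl : k = n + 1 := by omega
          simp [Polynomial.coeff_X_pow]
    · have hd : (∏ i, (Polynomial.X - Polynomial.C (y i))).natDegree ≤ n + 1 := by
        refine (Polynomial.natDegree_prod_le _ _).trans ?_
        refine (Finset.sum_le_card_nsmul _ _ 1
          fun i _ => Polynomial.natDegree_X_sub_C_le _).trans ?_
        simp
      rw [Polynomial.coeff_eq_zero_of_natDegree_lt (n := k) (lt_of_le_of_lt hd (by omega))]
      simp [Polynomial.coeff_X_pow, show k ≠ n + 1 by omega, show k ≠ n by omega]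

end SymmetricPolynomials


section Assembly

variable {K B : Type} [Field K] [CommRing B] [Algebra K B] {n : ℕ}

theorem IsMulFamily.aeval_mem {ℬ : ℤ → Submodule K B} (h : IsMulFamily ℬ) {x : Fin n → B}
    (hx : ∀ i, x i ∈ ℬ 1) {k : ℕ} {q : MvPolynomial (Fin n) K} (hq : q.IsHomogeneous k) :
    MvPolynomial.aeval x q ∈ ℬ k := by
  have hprod : ∀ (m : Fin n →₀ ℕ) (s : Finset (Fin n)),
      ∏ i ∈ s, x i ^ m i ∈ ℬ ((∑ i ∈ s, m i : ℕ) : ℤ) := by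
    intro m s
    induction s using Finset.induction_on with
    | empty => simpa using h.one_mem
    | insert i s hi ih =>
      rw [Finset.prod_insert hi, Finset.sum_insert hi, Nat.cast_add]
      exact h.mul_mem (h.pow_mem (hx i) _) ih
  rw [MvPolynomial.aeval_def, MvPolynomial.eval₂_eq']
  refine sum_mem fun m hm => ?_
  have hk : ∑ i, m i = k := by
    rw [← hq (MvPolynomial.mem_support_iff.1 hm), Finsupp.weight_apply,
      Finsupp.sum_fintype _ _ (by simp)]
    simp
  rw [← Algebra.smul_def, ← hk]
  exact Submodule.smul_mem _ _ (hprod m _)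

theorem isMulFamily_natToZ {ℒ : ℕ → Submodule K B} (h1 : (1 : B) ∈ ℒ 0)
    (hmul : ∀ {i j x y}, x ∈ ℒ i → y ∈ ℒ j → x * y ∈ ℒ (i + j)) : IsMulFamily (natToZ K ℒ) where
  one_mem := by simpa [natToZ] using h1
  mul_mem {i j x y} hx hy := by
    by_cases hi : 0 ≤ i
    · by_cases hj : 0 ≤ j
      · lift i to ℕ using hi
        lift j to ℕ using hj
        simp only [natToZ, ← Nat.cast_add, Int.natCast_nonneg, if_true, Int.toNat_natCast] at *
        exact hmul hx hy
      · rw [natToZ, if_neg hj, Submodule.mem_bot] at hy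
        simp [hy]
    · rw [natToZ, if_neg hi, Submodule.mem_bot] at hx
      simp [hx]

theorem algHasSLP_quotGrading [CharZero K] (hn : 0 < n) (f : MvPolynomial (Fin n) K) {d : ℕ}
    (hd : d ≠ 0) {a : K} (ha : a ≠ 0)
    (hf : f - MvPolynomial.C a * MvPolynomial.esymm (Fin n) K 1 ^ d ∈
      Ideal.span (Set.range fun j : Fin (n - 1) => MvPolynomial.esymm (Fin n) K ((j : ℕ) + 2))) :
    AlgHasSLP K (quotGrading K n (Ideal.span ((Set.range fun j : Fin (n - 1) =>
      MvPolynomial.esymm (Fin n) K ((j : ℕ) + 2)) ∪ {f}))) := by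
  set I := Ideal.span ((Set.range fun j : Fin (n - 1) =>
      MvPolynomial.esymm (Fin n) K ((j : ℕ) + 2)) ∪ {f})
  let g : Polynomial K := Polynomial.X ^ d
  have hg : g.Monic := Polynomial.monic_X_pow d
  have hgd : g.natDegree = d := Polynomial.natDegree_X_pow d
  let 𝒦 : ℤ → Submodule K K := fun k => if k = 0 then ⊤ else ⊥
  have hgh : g ∈ homogeneousPolys 𝒦 g.natDegree := by
    rw [hgd]
    change Polynomial.X ^ d ∈ _
    rw [← Polynomial.monomial_one_right_eq_X_pow]
    exact monomial_mem_homogeneousPolys (by simp [𝒦])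
  have hA := isLefschetzFamily_self.isLefschetzFamily_adjoinRootFamily hg hgh (s := d - 1)
    (by omega)
  have : FiniteDimensional K (AdjoinRoot g) := hg.finite_adjoinRoot
  have := nontrivial_adjoinRoot hg (by omega)
  set e := AdjoinRoot.root g
  have he : e ∈ adjoinRootFamily 𝒦 g 1 := (isLefschetzFamily_self (K := K)).root_mem
  have hed : e ^ d = 0 := by
    have := AdjoinRoot.mk_self (f := g)
    rwa [map_pow, AdjoinRoot.mk_X] at this
  let P : Polynomial (AdjoinRoot g) :=
    Polynomial.X ^ n - Polynomial.C e * Polynomial.X ^ (n - 1)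
  have hlt : (Polynomial.C e * Polynomial.X ^ (n - 1)).natDegree <
      (Polynomial.X ^ n : Polynomial (AdjoinRoot g)).natDegree := by
    rw [Polynomial.natDegree_X_pow]
    exact (Polynomial.natDegree_C_mul_X_pow_le _ _).trans_lt (by omega)
  have hPm : P.Monic := (Polynomial.monic_X_pow n).sub_of_left
    (Polynomial.degree_lt_degree hlt)
  have hPd : P.natDegree = n := by
    rw [Polynomial.natDegree_sub_eq_left_of_natDegree_lt hlt, Polynomial.natDegree_X_pow]
  have hPh : P ∈ homogeneousPolys (adjoinRootFamily 𝒦 g) n := by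
    refine sub_mem ?_ ?_
    · rw [← Polynomial.monomial_one_right_eq_X_pow]
      exact monomial_mem_homogeneousPolys (by simpa using hA.one_mem)
    · rw [Polynomial.C_mul_X_pow_eq_monomial]
      refine monomial_mem_homogeneousPolys ?_
      rwa [show (n : ℤ) - (n - 1 : ℕ) = 1 by omega]
  obtain ⟨B, _, _, ℬ, c, ι, x, _, _, hL, hsplit, huniv, hx, hι, hgen⟩ :=
    hA.exists_splitting n hPm hPd hPh
  have hmapP : ∀ (T : Type) [CommRing T] [Algebra K T] (φ : AdjoinRoot g →ₐ[K] T),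
      P.map (φ : AdjoinRoot g →+* T) =
        Polynomial.X ^ n - Polynomial.C (φ e) * Polynomial.X ^ (n - 1) := by
    intro T _ _ φ
    simp [P]
  rw [hmapP, prod_X_sub_C_eq_iff (K := K) hn] at hsplit
  obtain ⟨h1, h2⟩ := hsplit
  have hker : I ≤ RingHom.ker (MvPolynomial.aeval (R := K) x) := by
    have hle : Ideal.span (Set.range fun j : Fin (n - 1) =>
        MvPolynomial.esymm (Fin n) K ((j : ℕ) + 2)) ≤
        RingHom.ker (MvPolynomial.aeval (R := K) x) := by
      refine Ideal.span_le.2 ?_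
      rintro _ ⟨j, rfl⟩
      exact h2 j
    refine Ideal.span_le.2 (Set.union_subset (Ideal.span_le.1 hle) ?_)
    rintro _ rfl
    have := hle hf
    rwa [RingHom.mem_ker, map_sub, map_mul, map_pow, h1, ← map_pow, hed, map_zero, mul_zero,
      sub_zero] at this
  let ψ : (MvPolynomial (Fin n) K ⧸ I) →ₐ[K] B :=
    Ideal.Quotient.liftₐ I (MvPolynomial.aeval x) hker
  let y : Fin n → MvPolynomial (Fin n) K ⧸ I := fun i => Ideal.Quotient.mk I (MvPolynomial.X i)
  have hy : ∀ q, MvPolynomial.aeval y q = Ideal.Quotient.mk I q := by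
    have : MvPolynomial.aeval y = Ideal.Quotient.mkₐ K I := by
      ext i
      simp [y]
    exact fun q => DFunLike.congr_fun this q
  have hT : Ideal.Quotient.mk I (MvPolynomial.esymm (Fin n) K 1) ^ d = 0 := by
    rw [← map_pow, Ideal.Quotient.eq_zero_iff_mem]
    have hmem : MvPolynomial.C a * MvPolynomial.esymm (Fin n) K 1 ^ d ∈ I :=
      (Submodule.sub_mem_iff_right I (Ideal.subset_span (Or.inr rfl))).1
        (Ideal.span_mono Set.subset_union_left hf)
    have := I.mul_mem_left (MvPolynomial.C a⁻¹) hmem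
    rwa [← mul_assoc, ← map_mul, inv_mul_cancel₀ ha, map_one, one_mul] at this
  let φ : AdjoinRoot g →ₐ[K] MvPolynomial (Fin n) K ⧸ I :=
    AdjoinRoot.liftAlgHom g (Algebra.ofId K _)
      (Ideal.Quotient.mk I (MvPolynomial.esymm (Fin n) K 1))
      (by simp only [g, Polynomial.eval₂_X_pow, hT])
  have hφe : φ e = Ideal.Quotient.mk I (MvPolynomial.esymm (Fin n) K 1) :=
    AdjoinRoot.liftAlgHom_root ..
  obtain ⟨Φ, -, hΦ⟩ := huniv _ φ y (by
    rw [hmapP, prod_X_sub_C_eq_iff (K := K) hn, hφe]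
    exact ⟨hy _, fun j => (hy _).trans
      (Ideal.Quotient.eq_zero_iff_mem.2 (Ideal.subset_span (Or.inl ⟨j, rfl⟩)))⟩)
  have hinj : Function.Injective ψ := by
    refine Function.LeftInverse.injective (g := Φ) fun t => ?_
    obtain ⟨q, rfl⟩ := Ideal.Quotient.mk_surjective t
    change Φ (MvPolynomial.aeval x q) = _
    rw [← hy, MvPolynomial.comp_aeval_apply, funext hΦ]
  refine hL.algHasSLP ψ hinj fun k => ?_
  let ℒ : ℕ → Submodule K B := fun k =>
    (MvPolynomial.homogeneousSubmodule (Fin n) K k).map (MvPolynomial.aeval x).toLinearMap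
  have hmap : (quotGrading K n I k).map ψ.toLinearMap = ℒ k := by
    rw [quotGrading, ← Submodule.map_comp]
    rfl
  rw [hmap]
  apply le_antisymm
  · rintro _ ⟨q, hq, rfl⟩
    exact hL.aeval_mem hx ((MvPolynomial.mem_homogeneousSubmodule k q).1 hq)
  · have hD : IsMulFamily (natToZ K ℒ) := by
      refine isMulFamily_natToZ
        ⟨1, MvPolynomial.isHomogeneous_one _ _, map_one (MvPolynomial.aeval x)⟩ ?_
      rintro i j _ _ ⟨p, hp, rfl⟩ ⟨q, hq, rfl⟩
      exact ⟨p * q, MvPolynomial.IsHomogeneous.mul hp hq, map_mul (MvPolynomial.aeval x) p q⟩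
    have hDx : ∀ i, x i ∈ natToZ K ℒ 1 := fun i =>
      ⟨MvPolynomial.X i, MvPolynomial.isHomogeneous_X K i, MvPolynomial.aeval_X x i⟩
    have hDe : ι e ∈ natToZ K ℒ 1 := by
      rw [← h1, MvPolynomial.esymm_one, map_sum]
      exact sum_mem fun i _ => by rw [MvPolynomial.aeval_X]; exact hDx i
    have := hgen (natToZ K ℒ) hD ?_ hDx k
    · simpa [natToZ] using this
    · rintro k _ ⟨p, hp, rfl⟩
      change ι (AdjoinRoot.mk g p) ∈ _
      rw [p.as_sum_range_C_mul_X_pow, map_sum, map_sum]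
      refine sum_mem fun j _ => ?_
      have hpj := hp j
      by_cases hj : k - j = 0
      · obtain rfl : k = j := by omega
        have hC : ι (AdjoinRoot.mk g (Polynomial.C (p.coeff j))) = algebraMap K B (p.coeff j) :=
          ι.commutes _
        rw [map_mul, map_mul, hC, ← Algebra.smul_def, map_pow, map_pow, AdjoinRoot.mk_X]
        exact Submodule.smul_mem _ _ (hD.pow_mem hDe j)
      · have : p.coeff j = 0 := by simpa [𝒦, hj] using hpj
        simp [this]

end Assembly

/-- Proposition 8.1. Let `K` be a field of characteristic
zero and `f` a symmetric homogeneous polynomial of degree `d` in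
`R = K[x₁, …, x_n]` such that `e₂, e₃, …, e_n, f` is a regular sequence in the
ring `S` of symmetric polynomials.  Then `R/(e₂, e₃, …, e_n, f)R` has the
SLP. -/
theorem statement_17 (K : Type) [Field K] [CharZero K] (n : ℕ) (hn : 0 < n)
    (f : MvPolynomial (Fin n) K) (hfsym : f.IsSymmetric)
    (d : ℕ) (hfhom : f ∈ MvPolynomial.homogeneousSubmodule (Fin n) K d)
    (hreg : RingTheory.Sequence.IsRegular (↥(symS K n))
      (((List.range (n - 1)).map fun j => esymmS K n (j + 2)) ++
        [⟨f, (mem_symS K n _).mpr hfsym⟩])) :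
    AlgHasSLP K
      (quotGrading K n
        (Ideal.span
          ((Set.range fun j : Fin (n - 1) =>
              MvPolynomial.esymm (Fin n) K ((j : ℕ) + 2)) ∪ {f}))) := by
  obtain ⟨hd, a, ha, hmem⟩ := exists_sub_C_mul_esymm_one_pow_mem hn f hfsym d
    ((MvPolynomial.mem_homogeneousSubmodule d f).1 hfhom) hreg
  exact algHasSLP_quotGrading hn f hd ha hmem
end
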